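/- arXiv:1604.04230 — 2 statements merged into one kernel-verified Lean document; each statement's English description precedes it below -/
import Mathlib

section
/- Let (X, 𝓑, μ) be a probability space, let V : X → X be a measurable measure-preserving map, and let A ∈ 𝓑 with μ(A) > 0. Then for every k ≥ 1, for μ-almost every x ∈ A there is n ≥ 1 such that x ∈ V^{-ni}(A) for every i with 1 ≤ i ≤ k. -/
open MeasureTheory

namespace DensityHalesJewett

open Finset Function
open scoped BigOperators

/-- The average of a real function on a finite type. -/
noncomputable def avg {Ω : Type*} [Finite Ω] (f : Ω → ℝ) : ℝ :=
  letI := Fintype.ofFinite Ω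
  𝔼 x, f x

/-- The density of a subset of a finite type. -/
noncomputable def dens {Ω : Type*} [Finite Ω] (A : Set Ω) : ℝ :=
  avg (A.indicator fun _ => 1)

lemma indicator_one_le {Ω : Type*} (A : Set Ω) (x : Ω) :
    A.indicator (fun _ => (1 : ℝ)) x ≤ 1 := by
  by_cases h : x ∈ A <;> simp [h]

lemma indicator_one_nonneg {Ω : Type*} (A : Set Ω) (x : Ω) :
    0 ≤ A.indicator (fun _ => (1 : ℝ)) x := by
  by_cases h : x ∈ A <;> simp [h]

section Averages

variable {Ω Ω' : Type*} [Finite Ω] [Finite Ω']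

lemma avg_eq_expect [Fintype Ω] (f : Ω → ℝ) : avg f = 𝔼 x, f x := by
  unfold avg
  congr!

lemma avg_const [Nonempty Ω] (c : ℝ) : avg (fun _ : Ω => c) = c := by
  cases nonempty_fintype Ω
  rw [avg_eq_expect, Fintype.expect_const]

lemma avg_add (f g : Ω → ℝ) : avg (fun x => f x + g x) = avg f + avg g := by
  cases nonempty_fintype Ω
  simp only [avg_eq_expect, expect_add_distrib]

lemma avg_sub (f g : Ω → ℝ) : avg (fun x => f x - g x) = avg f - avg g := by
  cases nonempty_fintype Ω
  simp only [avg_eq_expect, expect_sub_distrib]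

lemma avg_const_mul (c : ℝ) (f : Ω → ℝ) : avg (fun x => c * f x) = c * avg f := by
  cases nonempty_fintype Ω
  simp only [avg_eq_expect, mul_expect]

lemma avg_mono {f g : Ω → ℝ} (h : ∀ x, f x ≤ g x) : avg f ≤ avg g := by
  cases nonempty_fintype Ω
  simp only [avg_eq_expect]
  exact expect_le_expect fun x _ => h x

lemma avg_nonneg {f : Ω → ℝ} (h : ∀ x, 0 ≤ f x) : 0 ≤ avg f := by
  cases nonempty_fintype Ω
  simp only [avg_eq_expect]
  exact expect_nonneg fun x _ => h x

lemma avg_prod (f : Ω × Ω' → ℝ) : avg f = avg fun x => avg fun y => f (x, y) := by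
  cases nonempty_fintype Ω
  cases nonempty_fintype Ω'
  simp only [avg_eq_expect]
  rw [← univ_product_univ, expect_product]

lemma avg_comm (f : Ω → Ω' → ℝ) :
    (avg fun x => avg fun y => f x y) = avg fun y => avg fun x => f x y := by
  cases nonempty_fintype Ω
  cases nonempty_fintype Ω'
  simp only [avg_eq_expect]
  rw [expect_comm]

lemma avg_equiv (e : Ω ≃ Ω') (f : Ω' → ℝ) : (avg fun x => f (e x)) = avg f := by
  cases nonempty_fintype Ω
  cases nonempty_fintype Ω'
  simp only [avg_eq_expect]
  exact Fintype.expect_equiv e _ _ fun _ => rfl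

lemma avg_finset_sum {Λ : Type*} (s : Finset Λ) (f : Λ → Ω → ℝ) :
    (avg fun x => ∑ l ∈ s, f l x) = ∑ l ∈ s, avg (f l) := by
  cases nonempty_fintype Ω
  simp only [avg_eq_expect, expect_sum_comm]

lemma avg_mul_card (f : Ω → ℝ) [Fintype Ω] : avg f * Nat.card Ω = ∑ x, f x := by
  rw [avg_eq_expect, Nat.card_eq_fintype_card, mul_comm, ← nsmul_eq_mul, ← Finset.card_univ,
    card_smul_expect]

lemma exists_avg_le [Nonempty Ω] (f : Ω → ℝ) : ∃ x, avg f ≤ f x := by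
  cases nonempty_fintype Ω
  rw [avg_eq_expect]
  obtain ⟨x, -, hx⟩ := exists_le_of_le_expect univ_nonempty (le_refl (𝔼 x, f x))
  exact ⟨x, hx⟩

lemma avg_le [Nonempty Ω] {f : Ω → ℝ} {c : ℝ} (h : ∀ x, f x ≤ c) : avg f ≤ c :=
  (avg_mono h).trans_eq (avg_const c)

lemma dens_nonneg (A : Set Ω) : 0 ≤ dens A := avg_nonneg (indicator_one_nonneg A)

lemma dens_le_one [Nonempty Ω] (A : Set Ω) : dens A ≤ 1 := avg_le (indicator_one_le A)

lemma dens_mono {A B : Set Ω} (h : A ⊆ B) : dens A ≤ dens B :=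
  avg_mono fun _ => Set.indicator_le_indicator_of_subset h (fun _ => zero_le_one) _

lemma nonempty_of_dens_pos {A : Set Ω} (h : 0 < dens A) : A.Nonempty := by
  by_contra! hA
  subst hA
  simp only [dens, Set.indicator_empty] at h
  have : avg (fun _ : Ω => (0 : ℝ)) = 0 * avg (fun _ : Ω => (0 : ℝ)) := by
    rw [← avg_const_mul]; simp
  rw [zero_mul] at this
  exact h.ne' this

lemma dens_preimage_equiv (e : Ω ≃ Ω') (A : Set Ω') : dens {x | e x ∈ A} = dens A :=
  avg_equiv e (A.indicator fun _ => 1)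

/-- Markov's inequality for functions bounded above by one. -/
lemma half_le_dens [Nonempty Ω] {F : Ω → ℝ} {c : ℝ} (hc : 0 ≤ c) (hF : ∀ x, F x ≤ 1)
    (h : c ≤ avg F) : c / 2 ≤ dens {x | c / 2 ≤ F x} := by
  have : avg F ≤ avg fun x => {x | c / 2 ≤ F x}.indicator (fun _ => (1 : ℝ)) x + c / 2 := by
    refine avg_mono fun x => ?_
    by_cases hx : c / 2 ≤ F x
    · simp only [Set.indicator, Set.mem_ofPred_eq, hx, if_true]
      linarith [hF x]
    · simp only [Set.indicator, Set.mem_ofPred_eq, hx, if_false]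
      linarith
  rw [avg_add, avg_const] at this
  change c / 2 ≤ avg _
  linarith

lemma dens_pigeonhole {Λ : Type*} [Finite Λ] (Q : Λ → Ω → Prop) {c : ℝ} (hc : 0 < c)
    (h : c ≤ dens {x | ∃ l, Q l x}) : ∃ l, c / (Nat.card Λ + 1) ≤ dens {x | Q l x} := by
  cases nonempty_fintype Λ
  by_contra! hlt
  have h1 : dens {x | ∃ l, Q l x} ≤ ∑ l, dens {x | Q l x} := by
    simp only [dens]
    rw [← avg_finset_sum]
    refine avg_mono fun x => ?_
    by_cases hx : ∃ l, Q l x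
    · obtain ⟨l, hl⟩ := hx
      have := single_le_sum (f := fun l => {x | Q l x}.indicator (fun _ => (1 : ℝ)) x)
        (fun l _ => indicator_one_nonneg _ x) (mem_univ l)
      refine le_trans ?_ this
      simp only [Set.indicator, Set.mem_ofPred_eq, hl, if_true]
      split_ifs <;> simp
    · simp only [Set.indicator, Set.mem_ofPred_eq, hx, if_false]
      exact sum_nonneg fun l _ => by split_ifs <;> simp
  have h2 : ∑ l, dens {x | Q l x} ≤ ∑ _l : Λ, c / (Nat.card Λ + 1) :=
    sum_le_sum fun l _ => (hlt l).le
  rw [sum_const, card_univ, nsmul_eq_mul, ← Nat.card_eq_fintype_card] at h2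
  have h3 : (Nat.card Λ : ℝ) * (c / (Nat.card Λ + 1)) < c := by
    rw [← mul_div_assoc, div_lt_iff₀ (by positivity)]
    nlinarith
  linarith

end Averages

section Words

variable {ι κ η β : Type} [Finite ι] [Finite κ] [Finite η] [Finite β]

lemma avg_sum_elim (f : (ι ⊕ κ → β) → ℝ) :
    avg f = avg fun x : ι → β => avg fun y : κ → β => f (Sum.elim x y) := by
  rw [← avg_equiv (Equiv.sumArrowEquivProdArrow ι κ β).symm f, avg_prod]
  rfl

lemma avg_reindex (e : ι ≃ κ) (f : (ι → β) → ℝ) : (avg fun x : κ → β => f (x ∘ e)) = avg f :=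
  avg_equiv (Equiv.arrowCongr e.symm (Equiv.refl β)) f

/-- The average of a product of functions of the separate letters. -/
lemma avg_prod_letters [Fintype ι] (h : β → ℝ) :
    (avg fun x : ι → β => ∏ i, h (x i)) = avg h ^ Nat.card ι := by
  classical
  cases nonempty_fintype β
  simp only [avg_eq_expect, Fintype.expect_eq_sum_div_card, Nat.card_eq_fintype_card, div_pow]
  rw [Fintype.card_fun, Nat.cast_pow]
  congr 1
  have := Finset.prod_univ_sum (fun _ : ι => (univ : Finset β)) (fun _ b => h b)
  rw [Fintype.piFinset_univ] at this
  rw [← this, prod_const, card_univ]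

end Words

lemma exists_sum_equiv (κ ι : Type) [Finite κ] [Finite ι] {n : ℕ}
    (h : Nat.card κ + n ≤ Nat.card ι) : ∃ k, n ≤ k ∧ Nonempty (κ ⊕ Fin k ≃ ι) := by
  refine ⟨Nat.card ι - Nat.card κ, by omega, ?_⟩
  rw [← Finite.card_eq, Nat.card_sum, Nat.card_fin]
  omega

section Subspaces

variable {ι κ η β : Type}

/-- The map `φ` parametrizes a combinatorial subspace of `ι → β` with wildcards indexed by `η`. -/
def IsSubspaceMap (φ : (η → β) → ι → β) : Prop :=
  ∃ s : ι → β ⊕ η, (∀ j, ∃ i, s i = Sum.inr j) ∧ ∀ v i, φ v i = Sum.elim id v (s i)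

/-- The point of the combinatorial line with template `g` whose wildcards take the value `a`. -/
def fill (g : ι → Option β) (a : β) : ι → β := fun i => (g i).getD a

/-- The set `A` contains a combinatorial line. -/
def HasLine (A : Set (ι → β)) : Prop :=
  ∃ g : ι → Option β, (∃ i, g i = none) ∧ ∀ a, fill g a ∈ A

lemma IsSubspaceMap.comp {φ : (κ → β) → ι → β} {ψ : (η → β) → κ → β} (hφ : IsSubspaceMap φ)
    (hψ : IsSubspaceMap ψ) : IsSubspaceMap fun v => φ (ψ v) := by
  obtain ⟨s, hs, hφ⟩ := hφ
  obtain ⟨t, ht, hψ⟩ := hψ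
  refine ⟨fun i => Sum.elim Sum.inl t (s i), fun j => ?_, fun v i => ?_⟩
  · obtain ⟨l, hl⟩ := ht j
    obtain ⟨i, hi⟩ := hs l
    exact ⟨i, by simp [hi, hl]⟩
  · change φ (ψ v) i = Sum.elim id v (Sum.elim Sum.inl t (s i))
    rw [hφ]
    rcases s i with b | l <;> simp [hψ]

lemma isSubspaceMap_reindex (e : ι ≃ κ) : IsSubspaceMap fun v : ι → β => v ∘ e.symm :=
  ⟨fun i => Sum.inr (e.symm i), fun j => ⟨e j, by simp⟩, fun _ _ => rfl⟩

lemma isSubspaceMap_elim_left (y : κ → β) : IsSubspaceMap fun v : ι → β => Sum.elim v y :=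
  ⟨Sum.elim Sum.inr fun i => Sum.inl (y i), fun j => ⟨Sum.inl j, rfl⟩,
    fun v i => by rcases i with i | i <;> rfl⟩

lemma isSubspaceMap_elim_right (x : ι → β) : IsSubspaceMap fun v : κ → β => Sum.elim x v :=
  ⟨Sum.elim (fun i => Sum.inl (x i)) Sum.inr, fun j => ⟨Sum.inr j, rfl⟩,
    fun v i => by rcases i with i | i <;> rfl⟩

lemma IsSubspaceMap.injective {φ : (η → β) → ι → β} (hφ : IsSubspaceMap φ) : Injective φ := by
  obtain ⟨s, hs, hφ⟩ := hφ
  intro v w h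
  funext j
  obtain ⟨i, hi⟩ := hs j
  have := congrFun h i
  simpa [hφ, hi] using this

lemma IsSubspaceMap.hasLine {φ : (η → β) → ι → β} (hφ : IsSubspaceMap φ) {A : Set (ι → β)}
    (h : HasLine {v | φ v ∈ A}) : HasLine A := by
  obtain ⟨s, hs, hφ⟩ := hφ
  obtain ⟨g, ⟨j, hj⟩, hg⟩ := h
  obtain ⟨i, hi⟩ := hs j
  refine ⟨fun i => Sum.elim some g (s i), ⟨i, by simp [hi, hj]⟩, fun a => ?_⟩
  have : fill (fun i => Sum.elim some g (s i)) a = φ (fill g a) := by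
    funext i
    rw [hφ]
    rcases hsi : s i with b | l <;> simp [fill, hsi]
  rw [this]
  exact hg a

end Subspaces

/-- The density Hales-Jewett property of an alphabet. -/
def HasDHJ (α : Type) [Finite α] : Prop :=
  ∀ δ : ℝ, 0 < δ → ∃ N : ℕ, ∀ (ι : Type) [Finite ι], N ≤ Nat.card ι →
    ∀ A : Set (ι → α), δ ≤ dens A → HasLine A

/-- The multidimensional density Hales-Jewett property follows from the one-dimensional one. -/
lemma HasDHJ.multidim {α : Type} [Finite α] [Nonempty α] (h : HasDHJ α) (m : ℕ) :
    ∀ δ : ℝ, 0 < δ → ∃ N : ℕ, ∀ (ι : Type) [Finite ι], N ≤ Nat.card ι →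
      ∀ A : Set (ι → α), δ ≤ dens A →
        ∃ φ : (Fin m → α) → ι → α, IsSubspaceMap φ ∧ ∀ v, φ v ∈ A := by
  induction m with
  | zero =>
    intro δ hδ
    refine ⟨0, fun ι _ _ A hA => ?_⟩
    obtain ⟨x, hx⟩ := nonempty_of_dens_pos (hδ.trans_le hA)
    exact ⟨fun _ => x, ⟨fun i => Sum.inl (x i), fun j => j.elim0, fun _ _ => rfl⟩, fun _ => hx⟩
  | succ m ih =>
    intro δ hδ
    obtain ⟨n₁, hn₁⟩ := h (δ / 2) (by positivity)
    set θ : ℝ := δ / 2 / (Nat.card (Fin n₁ → Option α) + 1) with hθ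
    have hθ0 : 0 < θ := by positivity
    obtain ⟨n₂, hn₂⟩ := ih θ hθ0
    refine ⟨n₁ + n₂, fun ι _ hι A hA => ?_⟩
    obtain ⟨k, hk, ⟨e⟩⟩ := exists_sum_equiv (Fin n₁) ι (n := n₂) (by simpa using hι)
    set T : (Fin k → α) → Set (Fin n₁ → α) := fun y => {x | Sum.elim x y ∘ e.symm ∈ A} with hT
    have hTd : δ ≤ avg fun y => dens (T y) := by
      refine hA.trans_eq ?_
      rw [dens, ← avg_reindex e.symm, avg_sum_elim, avg_comm]
      rfl
    have h1 := half_le_dens hδ.le (fun y => dens_le_one (T y)) hTd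
    have h2 : δ / 2 ≤ dens {y | ∃ g : Fin n₁ → Option α,
        (∃ i, g i = none) ∧ ∀ a, fill g a ∈ T y} :=
      h1.trans (dens_mono fun y hy => hn₁ (Fin n₁) (by simp) (T y) hy)
    obtain ⟨g, hg⟩ := dens_pigeonhole _ (by positivity) h2
    obtain ⟨y, ⟨i₀, hi₀⟩, -⟩ := nonempty_of_dens_pos (hθ0.trans_le hg)
    obtain ⟨φ, hφ, hφA⟩ := hn₂ (Fin k) (by simpa using hk) _ hg
    refine ⟨fun v => Sum.elim (fill g (v 0)) (φ (Fin.tail v)) ∘ e.symm, ?_,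
      fun v => (hφA (Fin.tail v)).2 (v 0)⟩
    refine (isSubspaceMap_reindex e).comp
      (ψ := fun v : Fin (m + 1) → α => Sum.elim (fill g (v 0)) (φ (Fin.tail v))) ?_
    obtain ⟨s, hs, hφ⟩ := hφ
    refine ⟨Sum.elim (fun i => (g i).elim (Sum.inr 0) Sum.inl)
      fun i => Sum.map id Fin.succ (s i), ?_, ?_⟩
    · refine Fin.cases ⟨Sum.inl i₀, by simp [hi₀]⟩ fun j => ?_
      obtain ⟨i, hi⟩ := hs j
      exact ⟨Sum.inr i, by simp [hi]⟩
    · rintro v (i | i)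
      · rcases hgi : g i with _ | b <;> simp [fill, hgi]
      · rcases hsi : s i with b | j <;> simp [hφ, hsi, Fin.tail]

section Insensitive

variable {ι κ η α : Type}

/-- Replace the letter `none` by the letter `r`. -/
def repl (r : α) (x : ι → Option α) : ι → Option α := fun i => some ((x i).getD r)

/-- Membership in `E` does not change when letters `none` and `r` are interchanged. -/
def Insensitive (r : α) (E : Set (ι → Option α)) : Prop := ∀ x, x ∈ E ↔ repl r x ∈ E

lemma Insensitive.mem_iff {r : α} {E : Set (ι → Option α)} (hE : Insensitive r E)
    {x y : ι → Option α} (h : repl r x = repl r y) : x ∈ E ↔ y ∈ E := by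
  rw [hE x, hE y, h]

lemma IsSubspaceMap.repl_apply_repl {φ : (η → Option α) → ι → Option α} (hφ : IsSubspaceMap φ)
    (r : α) (v : η → Option α) : repl r (φ (repl r v)) = repl r (φ v) := by
  funext i
  obtain ⟨s, -, hφ⟩ := hφ
  rcases hs : s i with b | j <;> simp [repl, hφ, hs]

lemma Insensitive.preimage {r : α} {E : Set (ι → Option α)} (hE : Insensitive r E)
    {φ : (η → Option α) → ι → Option α} (hφ : IsSubspaceMap φ) :
    Insensitive r {v | φ v ∈ E} :=
  fun v => hE.mem_iff (hφ.repl_apply_repl r v).symm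

/-- Replace the letters of `x` other than `none` by those of `u`. -/
def resample (x : ι → Option α) (u : ι → α) : ι → Option α := fun i => (x i).map fun _ => u i

/-- Interchange the letters of `x` other than `none` with the corresponding letters of `u`. -/
def swapLetters (p : (ι → Option α) × (ι → α)) : (ι → Option α) × (ι → α) :=
  (resample p.1 p.2, fun i => (p.1 i).getD (p.2 i))

lemma swapLetters_involutive : Involutive (swapLetters : (ι → Option α) × (ι → α) → _) := by
  rintro ⟨x, u⟩
  simp only [swapLetters, Prod.mk.injEq]
  constructor <;> funext i <;> rcases h : x i with _ | a <;> simp [resample, h]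

lemma avg_resample [Finite ι] [Finite α] [Nonempty α] (f : (ι → Option α) → ℝ) :
    (avg fun x => avg fun u => f (resample x u)) = avg f := by
  have h := avg_equiv swapLetters_involutive.toPerm
    (fun p : (ι → Option α) × (ι → α) => f p.1)
  rw [avg_prod, avg_prod] at h
  simp only [avg_const] at h
  exact h

end Insensitive

/-- Words over `Option α` typically have many letters other than `none`. -/
lemma exists_card_isSome_lt (α : Type) [Finite α] [Nonempty α] (n : ℕ) {γ : ℝ} (hγ : 0 < γ) :
    ∃ N : ℕ, ∀ (ι : Type) [Finite ι], N ≤ Nat.card ι →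
      dens {x : ι → Option α | Nat.card {i // (x i).isSome} < n} ≤ γ := by
  classical
  cases nonempty_fintype α
  set h : Option α → ℝ := fun o => if o.isSome then 1 / 2 else 1 with hh
  have h0 : 0 ≤ avg h := avg_nonneg fun o => by simp only [hh]; split_ifs <;> norm_num
  have h1 : avg h < 1 := by
    rw [avg_eq_expect]
    refine expect_lt (fun o _ => ?_) ⟨some (Classical.arbitrary α), mem_univ _, ?_⟩
    · simp only [hh]; split_ifs <;> norm_num
    · simp only [hh]; norm_num
  obtain ⟨N, hN⟩ := exists_pow_lt_of_lt_one (show 0 < γ / 2 ^ n by positivity) h1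
  refine ⟨N, fun ι _ hι => ?_⟩
  cases nonempty_fintype ι
  have hb : dens {x : ι → Option α | Nat.card {i // (x i).isSome} < n} ≤
      2 ^ n * avg fun x : ι → Option α => ∏ i, h (x i) := by
    rw [← avg_const_mul]
    refine avg_mono fun x => ?_
    have hp : ∏ i, h (x i) = (1 / 2) ^ Nat.card {i // (x i).isSome} := by
      simp only [hh, prod_ite, prod_const, one_pow, mul_one]
      rw [Nat.card_eq_fintype_card, Fintype.card_subtype]
    rw [hp]
    by_cases hx : Nat.card {i // (x i).isSome} < n
    · simp only [Set.indicator, Set.mem_ofPred_eq, hx, if_true]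
      calc (1 : ℝ) = 2 ^ n * (1 / 2) ^ n := by rw [← mul_pow]; norm_num
        _ ≤ _ := by
          gcongr ?_ * ?_
          exact pow_le_pow_of_le_one (by norm_num) (by norm_num) hx.le
    · simp only [Set.indicator, Set.mem_ofPred_eq, hx, if_false]
      positivity
  rw [avg_prod_letters] at hb
  have h2 : avg h ^ Nat.card ι ≤ γ / 2 ^ n :=
    (pow_le_pow_of_le_one h0 h1.le hι).trans hN.le
  calc _ ≤ _ := hb
    _ ≤ 2 ^ n * (γ / 2 ^ n) := by gcongr
    _ = γ := by field_simp

/-- Few words over `Option α` avoid the letter `none`. -/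
lemma exists_dens_isSome_le (α : Type) [Finite α] {γ : ℝ} (hγ : 0 < γ) :
    ∃ N : ℕ, ∀ (ι : Type) [Finite ι], N ≤ Nat.card ι →
      dens {x : ι → Option α | ∀ i, (x i).isSome} ≤ γ := by
  classical
  cases nonempty_fintype α
  set h : Option α → ℝ := fun o => if o.isSome then 1 else 0 with hh
  have h0 : 0 ≤ avg h := avg_nonneg fun o => by simp only [hh]; split_ifs <;> norm_num
  have h1 : avg h < 1 := by
    rw [avg_eq_expect]
    refine expect_lt (fun o _ => ?_) ⟨none, mem_univ _, ?_⟩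
    · simp only [hh]; split_ifs <;> norm_num
    · simp only [hh]; norm_num
  obtain ⟨N, hN⟩ := exists_pow_lt_of_lt_one hγ h1
  refine ⟨N, fun ι _ hι => ?_⟩
  cases nonempty_fintype ι
  have hb : dens {x : ι → Option α | ∀ i, (x i).isSome} ≤
      avg fun x : ι → Option α => ∏ i, h (x i) := by
    refine avg_mono fun x => ?_
    by_cases hx : ∀ i, (x i).isSome
    · simp [Set.indicator, hx, hh]
    · simp only [Set.indicator, Set.mem_ofPred_eq, hx, if_false]
      exact prod_nonneg fun i _ => by simp only [hh]; split_ifs <;> norm_num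
  rw [avg_prod_letters] at hb
  exact hb.trans ((pow_le_pow_of_le_one h0 h1.le hι).trans hN.le)

/-- If the averages of `f` over all parametrized subspaces are nonpositive, then so is the average
of the restriction of `f` to the image of a parametrized subspace. -/
lemma avg_indicator_range_nonpos {ι η α : Type} [Finite ι] [Finite η] [Finite α]
    {f : (ι → Option α) → ℝ} {φ : (η → Option α) → ι → Option α} (hφ : IsSubspaceMap φ)
    (hf : avg (fun v => f (φ v)) ≤ 0) : avg ((Set.range φ).indicator f) ≤ 0 := by
  classical
  cases nonempty_fintype (ι → Option α)
  cases nonempty_fintype (η → Option α)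
  have h1 : ∑ v, f (φ v) ≤ 0 := by
    rw [← avg_mul_card]
    exact mul_nonpos_of_nonpos_of_nonneg hf (by positivity)
  have h2 : ∑ x, (Set.range φ).indicator f x = ∑ v, f (φ v) := by
    rw [← sum_image (g := φ) (fun x _ y _ h => hφ.injective h)]
    rw [← sum_indicator_subset f (subset_univ (univ.image φ))]
    simp
  rw [avg_eq_expect, Fintype.expect_eq_sum_div_card, h2]
  exact div_nonpos_of_nonpos_of_nonneg h1 (by positivity)

section Complement

variable {α : Type} [Finite α] [Nonempty α]

/-- A dense insensitive set contains a combinatorial subspace. -/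
lemma HasDHJ.exists_subspace_of_insensitive (h : HasDHJ α) (r : α) (m : ℕ) {γ : ℝ} (hγ : 0 < γ) :
    ∃ N : ℕ, ∀ (ι : Type) [Finite ι], N ≤ Nat.card ι → ∀ E : Set (ι → Option α),
      Insensitive r E → γ ≤ dens E →
        ∃ φ : (Fin m → Option α) → ι → Option α, IsSubspaceMap φ ∧ ∀ v, φ v ∈ E := by
  classical
  obtain ⟨n, hn⟩ := h.multidim m (γ / 4) (by positivity)
  obtain ⟨N, hN⟩ := exists_card_isSome_lt α n (show 0 < γ / 2 by positivity)
  refine ⟨N, fun ι _ hι E hE hγE => ?_⟩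
  set H : (ι → Option α) → ℝ := fun x => dens {u : ι → α | resample x u ∈ E} with hH
  have hHE : avg H = dens E := avg_resample (E.indicator fun _ => 1)
  have hx : ∃ x : ι → Option α, n ≤ Nat.card {i // (x i).isSome} ∧ γ / 4 ≤ H x := by
    by_contra! hcon
    have h1 : avg H ≤ avg fun x => {x : ι → Option α | Nat.card {i // (x i).isSome} < n}.indicator
        (fun _ => (1 : ℝ)) x + γ / 4 := by
      refine avg_mono fun x => ?_
      by_cases hx : Nat.card {i // (x i).isSome} < n
      · simp only [Set.indicator, Set.mem_ofPred_eq, hx, if_true]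
        linarith [dens_le_one {u : ι → α | resample x u ∈ E}]
      · simp only [Set.indicator, Set.mem_ofPred_eq, hx, if_false, zero_add]
        exact (hcon x (not_lt.mp hx)).le
    rw [avg_add, avg_const] at h1
    have h2 := hN ι hι
    rw [dens] at h2
    linarith
  obtain ⟨x, hxn, hxE⟩ := hx
  set ext : ({i // (x i).isSome} → α) → ι → Option α :=
    fun u i => if hi : (x i).isSome then some (u ⟨i, hi⟩) else none with hext
  have hd : dens {u | ext u ∈ E} = H x := by
    simp only [hH]
    rw [dens, dens,
      ← avg_equiv (Equiv.piEquivPiSubtypeProd (fun i => (x i).isSome) fun _ => α).symm, avg_prod]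
    refine congrArg avg (funext fun u => ?_)
    rw [← avg_const (Ω := {i // ¬ (x i).isSome} → α) (Set.indicator {u | ext u ∈ E} _ u)]
    refine congrArg avg (funext fun w => ?_)
    have : resample x ((Equiv.piEquivPiSubtypeProd (fun i => (x i).isSome) fun _ => α).symm (u, w))
        = ext u := by
      funext i
      simp only [resample, hext, Equiv.piEquivPiSubtypeProd_symm_apply]
      by_cases hi : (x i).isSome
      · obtain ⟨a, ha⟩ := Option.isSome_iff_exists.mp hi
        simp [ha]
      · simp only [hi, Bool.false_eq_true, dite_false]
        rw [Option.not_isSome_iff_eq_none] at hi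
        simp [hi]
    simp only [Set.indicator, Set.mem_ofPred_eq, this]
  obtain ⟨φ, hφ, hφE⟩ := hn {i // (x i).isSome} hxn {u | ext u ∈ E} (by rw [hd]; exact hxE)
  obtain ⟨s, hs, hφ⟩ := hφ
  set t : ι → Option α ⊕ Fin m :=
    fun i => if hi : (x i).isSome then Sum.map some id (s ⟨i, hi⟩) else Sum.inl none with ht
  refine ⟨fun v i => Sum.elim id v (t i), ⟨t, fun j => ?_, fun _ _ => rfl⟩, fun v => ?_⟩
  · obtain ⟨⟨i, hi⟩, hij⟩ := hs j
    exact ⟨i, by simp [ht, hi, hij]⟩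
  · refine (hE.mem_iff (y := ext (φ fun j => (v j).getD r)) ?_).mpr (hφE _)
    funext i
    by_cases hi : (x i).isSome
    · rcases hsi : s ⟨i, hi⟩ with b | j <;> simp [repl, hext, ht, hi, hφ, hsi]
    · simp [repl, hext, ht, hi]

/-- The iterative step in the decomposition of insensitive sets into subspaces. -/
lemma avg_insensitive_le_max {r : α} {m n : ℕ} {γ : ℝ} (hγ : 0 < γ)
    (hn : ∀ E : Set (Fin n → Option α), Insensitive r E → γ / 2 ≤ dens E →
      ∃ φ : (Fin m → Option α) → Fin n → Option α, IsSubspaceMap φ ∧ ∀ v, φ v ∈ E) (j : ℕ) :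
    ∀ (T ι : Type) [Finite T] [Nonempty T] [Finite ι], j * n ≤ Nat.card ι →
      ∀ (f : T → (ι → Option α) → ℝ) (E : T → Set (ι → Option α)), (∀ t x, f t x ≤ 1) →
      (∀ t (φ : (Fin m → Option α) → ι → Option α), IsSubspaceMap φ →
        avg (fun v => f t (φ v)) ≤ 0) → (∀ t, Insensitive r (E t)) →
      avg (fun t => avg ((E t).indicator (f t))) ≤
        max γ (avg (fun t => dens (E t)) -
          j * (γ / 2 * ((Nat.card (Fin n → Option α) : ℝ)⁻¹))) := by
  classical
  set b : ℝ := (Nat.card (Fin n → Option α) : ℝ)⁻¹ with hb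
  have hle : ∀ {ι : Type} [Finite ι] (f : (ι → Option α) → ℝ) (E : Set (ι → Option α)),
      (∀ x, f x ≤ 1) → avg (E.indicator f) ≤ dens E := fun f E hf =>
    avg_mono fun x => by by_cases hx : x ∈ E <;> simp [hx, hf]
  induction j with
  | zero =>
    intro T ι _ _ _ _ f E hf _ _
    refine le_max_of_le_right ?_
    simp only [CharP.cast_eq_zero, zero_mul, sub_zero]
    exact avg_mono fun t => hle _ _ (hf t)
  | succ j ih =>
    intro T ι _ _ _ hι f E hf hφ hE
    by_cases hd : avg (fun t => dens (E t)) ≤ γ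
    · exact le_max_of_le_left ((avg_mono fun t => hle _ _ (hf t)).trans hd)
    push Not at hd
    obtain ⟨k, hk, ⟨e⟩⟩ := exists_sum_equiv (Fin n) ι (n := j * n) (by
      rw [Nat.card_fin]; linarith [hι, Nat.succ_mul j n])
    let join : (Fin n → Option α) → (Fin k → Option α) → ι → Option α :=
      fun x y => Sum.elim x y ∘ e.symm
    have hjl : ∀ y, IsSubspaceMap fun x => join x y := fun y =>
      (isSubspaceMap_reindex e).comp (isSubspaceMap_elim_left y)
    have hjr : ∀ x, IsSubspaceMap fun y => join x y := fun x =>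
      (isSubspaceMap_reindex e).comp (isSubspaceMap_elim_right x)
    have hjavg : ∀ F : (ι → Option α) → ℝ, avg F = avg fun x => avg fun y => F (join x y) :=
      fun F => by rw [← avg_reindex e.symm, avg_sum_elim]
    have hR : ∀ F : Set (Fin n → Option α), ∃ R : Set (Fin n → Option α), R ⊆ F ∧
        (∀ g : (Fin n → Option α) → ℝ, (∀ φ : (Fin m → Option α) → Fin n → Option α,
          IsSubspaceMap φ → avg (fun v => g (φ v)) ≤ 0) → avg (R.indicator g) ≤ 0) ∧
        (Insensitive r F → γ / 2 ≤ dens F → b ≤ dens R) := by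
      intro F
      by_cases hF : ∃ φ : (Fin m → Option α) → Fin n → Option α, IsSubspaceMap φ ∧ ∀ v, φ v ∈ F
      · obtain ⟨φ, hφ, hφF⟩ := hF
        refine ⟨Set.range φ, Set.range_subset_iff.mpr hφF,
          fun g hg => avg_indicator_range_nonpos hφ (hg φ hφ), fun _ _ => ?_⟩
        have hs : ({φ fun _ => none} : Set (Fin n → Option α)) ⊆ Set.range φ := by
          rintro _ rfl
          exact ⟨_, rfl⟩
        refine le_trans ?_ (dens_mono hs)
        cases nonempty_fintype (Fin n → Option α)
        rw [dens, avg_eq_expect, Fintype.expect_eq_sum_div_card, hb, Nat.card_eq_fintype_card]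
        simp [Set.indicator]
      · refine ⟨∅, Set.empty_subset F, fun g _ => ?_, fun h1 h2 => absurd (hn F h1 h2) hF⟩
        simp [avg_const]
    choose R hRF hRavg hRd using hR
    let F : T → (Fin k → Option α) → Set (Fin n → Option α) := fun t y => {x | join x y ∈ E t}
    have hFins : ∀ t y, Insensitive r (F t y) := fun t y => (hE t).preimage (hjl y)
    let E' : T × (Fin n → Option α) → Set (Fin k → Option α) :=
      fun p => {y | join p.2 y ∈ E p.1 ∧ p.2 ∉ R (F p.1 y)}
    have hE' : ∀ p, Insensitive r (E' p) := by
      intro p y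
      have h1 : ∀ x, join x y ∈ E p.1 ↔ join x (repl r y) ∈ E p.1 := fun x =>
        (hE p.1).preimage (hjr x) y
      have h2 : F p.1 y = F p.1 (repl r y) := Set.ext h1
      change (join p.2 y ∈ E p.1 ∧ p.2 ∉ R (F p.1 y)) ↔
        (join p.2 (repl r y) ∈ E p.1 ∧ p.2 ∉ R (F p.1 (repl r y)))
      rw [h1, h2]
    have hIH := ih (T × (Fin n → Option α)) (Fin k) (by simpa using hk)
      (fun p y => f p.1 (join p.2 y)) E' (fun p y => hf _ _)
      (fun p φ hφ' => hφ p.1 _ ((hjr p.2).comp hφ')) hE'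
    have hsplit : ∀ g : T → (ι → Option α) → ℝ, avg (fun t => avg ((E t).indicator (g t))) =
        avg (fun p : T × (Fin n → Option α) =>
          avg ((E' p).indicator fun y => g p.1 (join p.2 y))) +
        avg (fun t => avg fun y => avg ((R (F t y)).indicator fun x => g t (join x y))) := by
      intro g
      rw [avg_prod, ← avg_add]
      refine congrArg avg (funext fun t => ?_)
      rw [hjavg, avg_comm (fun y x => (R (F t y)).indicator (fun x => g t (join x y)) x),
        ← avg_add]
      refine congrArg avg (funext fun x => ?_)
      rw [← avg_add]
      refine congrArg avg (funext fun y => ?_)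
      have hsub : x ∈ R (F t y) → join x y ∈ E t := fun h => hRF _ h
      by_cases h1 : join x y ∈ E t <;> by_cases h2 : x ∈ R (F t y)
      · simp [Set.indicator, E', h1, h2]
      · simp [Set.indicator, E', h1, h2]
      · exact absurd (hsub h2) h1
      · simp [Set.indicator, E', h1, h2]
    have hneg : avg (fun t => avg fun y =>
        avg ((R (F t y)).indicator fun x => f t (join x y))) ≤ 0 :=
      avg_le fun t => avg_le fun y =>
        hRavg _ _ fun φ hφ' => hφ t _ ((hjl y).comp hφ')
    have hdens : avg (fun t => dens (E t)) = avg (fun p => dens (E' p)) +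
        avg (fun t => avg fun y => dens (R (F t y))) := hsplit fun _ _ => 1
    have hFd : avg (fun t => dens (E t)) = avg fun p : T × (Fin k → Option α) =>
        dens (F p.1 p.2) := by
      rw [avg_prod]
      refine congrArg avg (funext fun t => ?_)
      rw [dens, hjavg, avg_comm]
      rfl
    have hgain : γ / 2 * b ≤ avg (fun t => avg fun y => dens (R (F t y))) := by
      have h1 := half_le_dens hγ.le
        (fun p : T × (Fin k → Option α) => dens_le_one (F p.1 p.2)) (hFd ▸ hd.le)
      calc γ / 2 * b ≤ b * dens {p : T × (Fin k → Option α) | γ / 2 ≤ dens (F p.1 p.2)} := by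
            rw [mul_comm]
            gcongr
        _ ≤ avg fun p : T × (Fin k → Option α) => dens (R (F p.1 p.2)) := by
            rw [dens, ← avg_const_mul]
            refine avg_mono fun p => ?_
            by_cases hp : γ / 2 ≤ dens (F p.1 p.2)
            · simpa [Set.indicator, hp] using hRd _ (hFins _ _) hp
            · simpa [Set.indicator, hp] using dens_nonneg _
        _ = _ := avg_prod _
    rw [hsplit f]
    refine (add_le_add hIH hneg).trans ?_
    rw [add_zero]
    refine max_le_max le_rfl ?_
    push_cast
    linarith

/-- If `f` has nonpositive average over all subspaces of a fixed dimension, then it has small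
average over insensitive sets. -/
lemma HasDHJ.exists_avg_insensitive_le (h : HasDHJ α) (r : α) (m : ℕ) {γ : ℝ} (hγ : 0 < γ) :
    ∃ N : ℕ, ∀ (ι : Type) [Finite ι], N ≤ Nat.card ι →
      ∀ (f : (ι → Option α) → ℝ) (E : Set (ι → Option α)), (∀ x, f x ≤ 1) →
      (∀ φ : (Fin m → Option α) → ι → Option α, IsSubspaceMap φ → avg (fun v => f (φ v)) ≤ 0) →
      Insensitive r E → avg (E.indicator f) ≤ γ := by
  obtain ⟨n, hn⟩ := h.exists_subspace_of_insensitive r m (γ := γ / 2) (by positivity)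
  set c : ℝ := γ / 2 * ((Nat.card (Fin n → Option α) : ℝ)⁻¹) with hc
  have hc0 : 0 < c := by
    have : 0 < Nat.card (Fin n → Option α) := Nat.card_pos
    positivity
  obtain ⟨j, hj⟩ := exists_nat_gt (1 / c)
  refine ⟨j * n, fun ι _ hι f E hf hφ hE => ?_⟩
  have := avg_insensitive_le_max hγ (hn (Fin n) (by simp)) j Unit ι hι (fun _ => f) (fun _ => E)
    (fun _ => hf) (fun _ => hφ) fun _ => hE
  rw [avg_const, avg_const, ← hc] at this
  refine this.trans (max_le le_rfl ?_)
  have h1 := dens_le_one E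
  rw [div_lt_iff₀ hc0] at hj
  linarith

/-- If `f` has nonpositive average over all subspaces of a fixed dimension, then it has small
average over the complement of an intersection of insensitive sets. -/
lemma HasDHJ.exists_avg_compl_le (h : HasDHJ α) (s : Finset α) (m : ℕ) :
    ∀ γ : ℝ, 0 < γ → ∃ N : ℕ, ∀ (ι : Type) [Finite ι], N ≤ Nat.card ι →
      ∀ (f : (ι → Option α) → ℝ) (C : α → Set (ι → Option α)), (∀ x, f x ≤ 1) →
      (∀ φ : (Fin m → Option α) → ι → Option α, IsSubspaceMap φ → avg (fun v => f (φ v)) ≤ 0) →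
      (∀ r, Insensitive r (C r)) → avg ({x | ∀ r ∈ s, x ∈ C r}ᶜ.indicator f) ≤ γ := by
  classical
  induction s using Finset.induction_on with
  | empty =>
    intro γ hγ
    refine ⟨0, fun ι _ _ f C _ _ _ => ?_⟩
    simp [avg_const, hγ.le]
  | insert r s hr ih =>
    intro γ hγ
    obtain ⟨M, hM⟩ := ih (γ / 3) (by positivity)
    obtain ⟨N₁, hN₁⟩ := h.exists_avg_insensitive_le r M (γ := γ / 3) (by positivity)
    obtain ⟨N₂, hN₂⟩ := h.exists_avg_insensitive_le r m (γ := γ / 3) (by positivity)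
    refine ⟨max N₁ N₂, fun ι _ hι f C hf hφ hC => ?_⟩
    set D : Set (ι → Option α) := {x | ∀ r ∈ s, x ∈ C r} with hD
    have h1 : avg ((C r).indicator fun x => Dᶜ.indicator f x - γ / 3) ≤ γ / 3 := by
      refine hN₁ ι (le_of_max_le_left hι) _ _ (fun x => ?_) (fun φ hφ' => ?_) (hC r)
      · by_cases hx : x ∈ Dᶜ
        · rw [Set.indicator_of_mem hx]; linarith [hf x]
        · rw [Set.indicator_of_notMem hx]; linarith
      · rw [avg_sub, avg_const, sub_nonpos]
        exact hM (Fin M) (by simp) (fun v => f (φ v)) (fun r => {v | φ v ∈ C r})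
          (fun v => hf _) (fun ψ hψ => hφ _ (hφ'.comp hψ)) fun r => (hC r).preimage hφ'
    have h2 : avg ((C r)ᶜ.indicator f) ≤ γ / 3 :=
      hN₂ ι (le_of_max_le_right hι) _ _ hf hφ fun x => not_congr (hC r x)
    have h3 : avg ({x | ∀ r' ∈ insert r s, x ∈ C r'}ᶜ.indicator f) ≤
        avg fun x => (C r)ᶜ.indicator f x +
          ((C r).indicator (fun x => Dᶜ.indicator f x - γ / 3) x + γ / 3) := by
      refine avg_mono fun x => ?_
      have hiff : x ∈ {x | ∀ r' ∈ insert r s, x ∈ C r'}ᶜ ↔ ¬ (x ∈ C r ∧ x ∈ D) := by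
        simp [hD]
      by_cases hx : x ∈ C r <;> by_cases hxD : x ∈ D
      · rw [Set.indicator_of_notMem (by rw [hiff]; tauto)]
        simp [hx, hxD]
      · rw [Set.indicator_of_mem (by rw [hiff]; tauto)]
        simp [hx, hxD]
      · rw [Set.indicator_of_mem (by rw [hiff]; tauto)]
        simpa [hx] using (show 0 ≤ γ / 3 by positivity)
      · rw [Set.indicator_of_mem (by rw [hiff]; tauto)]
        simpa [hx] using (show 0 ≤ γ / 3 by positivity)
    rw [avg_add, avg_add, avg_const] at h3
    linarith

end Complement

section Increment

lemma le_card_mul_avg {Ω : Type*} [Finite Ω] {f : Ω → ℝ} (h : ∀ x, 0 ≤ f x) (x : Ω) :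
    f x ≤ Nat.card Ω * avg f := by
  cases nonempty_fintype Ω
  rw [mul_comm, avg_mul_card]
  exact single_le_sum (fun y _ => h y) (mem_univ x)

variable {α : Type} [Finite α] [Nonempty α]

/-- If line-free sets have density at most about `δ`, then they have density smaller than `δ`. -/
lemma HasDHJ.exists_dens_decrement (h : HasDHJ α) {δ : ℝ} (hδ : 0 < δ)
    (hup : ∀ ε : ℝ, 0 < ε → ∃ N : ℕ, ∀ (ι : Type) [Finite ι], N ≤ Nat.card ι →
      ∀ A : Set (ι → Option α), ¬ HasLine A → dens A ≤ δ + ε) :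
    ∃ ε : ℝ, 0 < ε ∧ ∃ N : ℕ, ∀ (ι : Type) [Finite ι], N ≤ Nat.card ι →
      ∀ A : Set (ι → Option α), ¬ HasLine A → dens A ≤ δ - ε := by
  classical
  cases nonempty_fintype α
  obtain ⟨n, hn⟩ := h (δ / 2 / 2) (by positivity)
  set θ : ℝ := δ / 2 / 2 / (Nat.card (Fin n → Option α) + 1) with hθ
  have hθ0 : 0 < θ := by positivity
  set ε₀ : ℝ := δ * θ / 8 with hε₀
  have hε₀0 : 0 < ε₀ := by positivity
  obtain ⟨m, hm⟩ := hup ε₀ hε₀0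
  obtain ⟨K, hK⟩ := h.exists_avg_compl_le univ m ε₀ hε₀0
  obtain ⟨K', hK'⟩ := exists_dens_isSome_le α hε₀0
  set M := max K K' with hM
  set b : ℝ := ((Nat.card (Fin n × Fin M → Option α) : ℕ) : ℝ) with hb
  have hb0 : 0 < b := by
    have : 0 < Nat.card (Fin n × Fin M → Option α) := Nat.card_pos
    positivity
  set ε₁ : ℝ := min (δ / 2) ε₀ with hε₁
  have hε₁0 : 0 < ε₁ := lt_min (by positivity) hε₀0
  set ε : ℝ := ε₁ / (2 * b) with hε
  have hε0 : 0 < ε := by positivity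
  obtain ⟨N, hN⟩ := hup ε hε0
  refine ⟨ε, hε0, Nat.card (Fin n × Fin M) + N, fun ι _ hι A hA => ?_⟩
  by_contra! hAd
  obtain ⟨k, hk, ⟨e⟩⟩ := exists_sum_equiv (Fin n × Fin M) ι hι
  let join : (Fin n × Fin M → Option α) → (Fin k → Option α) → ι → Option α :=
    fun x y => Sum.elim x y ∘ e.symm
  have hjl : ∀ y, IsSubspaceMap fun x => join x y := fun y =>
    (isSubspaceMap_reindex e).comp (isSubspaceMap_elim_left y)
  have hjr : ∀ x, IsSubspaceMap fun y => join x y := fun x =>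
    (isSubspaceMap_reindex e).comp (isSubspaceMap_elim_right x)
  have hslice : ∀ x, δ - ε₁ ≤ dens {y | join x y ∈ A} := by
    intro x
    have hle : ∀ x, 0 ≤ δ + ε - dens {y | join x y ∈ A} := fun x => by
      rw [sub_nonneg]
      exact hN (Fin k) (by simpa using hk) _ fun hl => hA ((hjr x).hasLine hl)
    have h1 := le_card_mul_avg hle x
    have h2 : avg (fun x => dens {y | join x y ∈ A}) = dens A := by
      rw [dens, ← avg_reindex e.symm, avg_sum_elim]
      rfl
    rw [avg_sub, avg_const, h2, ← hb] at h1
    have h3 : b * (δ + ε - dens A) ≤ b * (2 * ε) := by gcongr; linarith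
    have h4 : b * (2 * ε) = ε₁ := by rw [hε]; field_simp
    linarith
  -- Find a template whose lines lie in the set with positive probability.
  let U : (Fin n × Fin M → Option α) → (Fin n → α) → Fin n × Fin M → Option α :=
    fun w t q => (w q).or (some (t q.1))
  let T : (Fin k → Option α) × (Fin n × Fin M → Option α) → Set (Fin n → α) :=
    fun p => {t | join (U p.2 t) p.1 ∈ A}
  have hT : δ / 2 ≤ avg fun p => dens (T p) := by
    have h1 : avg (fun p => dens (T p)) =
        avg fun w => avg fun t => dens {y | join (U w t) y ∈ A} := by
      rw [avg_prod, avg_comm]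
      refine congrArg avg (funext fun w => ?_)
      simp only [dens]
      rw [avg_comm]
      rfl
    rw [h1]
    have h2 : avg (fun _ : Fin n × Fin M → Option α => avg fun _ : Fin n → α => δ / 2) = δ / 2 := by
      simp only [avg_const]
    rw [← h2]
    refine avg_mono fun w => avg_mono fun t => le_trans ?_ (hslice _)
    linarith [min_le_left (δ / 2) ε₀]
  have hline : δ / 2 / 2 ≤ dens {p | ∃ g : Fin n → Option α,
      (∃ i, g i = none) ∧ ∀ a, fill g a ∈ T p} :=
    (half_le_dens (by positivity) (fun p => dens_le_one (T p)) hT).trans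
      (dens_mono fun p hp => hn (Fin n) (by simp) (T p) hp)
  obtain ⟨g, hg⟩ := dens_pigeonhole _ (by positivity) hline
  obtain ⟨-, ⟨i₀, hi₀⟩, -⟩ := nonempty_of_dens_pos (hθ0.trans_le hg)
  -- The corresponding random subspace.
  let s := Equiv.piEquivPiSubtypeProd (fun q : Fin n × Fin M => g q.1 = none) fun _ => Option α
  let W : (Fin k → Option α) × ({q : Fin n × Fin M // ¬ g q.1 = none} → Option α) →
      ({q : Fin n × Fin M // g q.1 = none} → Option α) → ι → Option α :=
    fun z v => join (fun q => (s.symm (v, z.2) q).or (g q.1)) z.1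
  have hW : ∀ z, IsSubspaceMap (W z) := by
    intro z
    refine (hjl z.1).comp (ψ := fun v q => (s.symm (v, z.2) q).or (g q.1))
      ⟨fun q => if hq : g q.1 = none then Sum.inr ⟨q, hq⟩
        else Sum.inl ((z.2 ⟨q, hq⟩).or (g q.1)), fun j => ⟨j.1, by simp [j.2]⟩, fun v q => ?_⟩
    by_cases hq : g q.1 = none <;> simp [s, hq]
  have hWU : ∀ z v a, W z (repl a v) = join (U (s.symm (v, z.2)) (fill g a)) z.1 := by
    intro z v a
    refine congrArg (fun x => join x z.1) (funext fun q => ?_)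
    rcases hq : g q.1 with _ | c
    · rcases hv : v ⟨q, hq⟩ with _ | c <;> simp [U, s, fill, repl, hq, hv]
    · simp [U, s, fill, hq]
  let C : (Fin k → Option α) × ({q : Fin n × Fin M // ¬ g q.1 = none} → Option α) → α →
      Set ({q : Fin n × Fin M // g q.1 = none} → Option α) :=
    fun z a => {v | W z (repl a v) ∈ A}
  let D := fun z => {v | ∀ a ∈ (univ : Finset α), v ∈ C z a}
  have hDavg : θ ≤ avg fun z => dens (D z) := by
    refine hg.trans_eq ?_
    simp only [dens]
    rw [avg_prod, avg_prod]
    refine congrArg avg (funext fun y => ?_)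
    rw [← avg_equiv s.symm, avg_prod, avg_comm]
    refine congrArg avg (funext fun w => congrArg avg (funext fun v => ?_))
    have : v ∈ D (y, w) ↔ (y, s.symm (v, w)) ∈
        {p | (∃ i, g i = none) ∧ ∀ a, fill g a ∈ T p} := by
      simp only [D, C, T, Set.mem_ofPred_eq, mem_univ, forall_true_left, hWU]
      exact ⟨fun h => ⟨⟨i₀, hi₀⟩, h⟩, fun h => h.2⟩
    by_cases hv : v ∈ D (y, w)
    · rw [Set.indicator_of_mem hv, Set.indicator_of_mem (this.mp hv)]
    · rw [Set.indicator_of_notMem hv, Set.indicator_of_notMem fun h => hv (this.mpr h)]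
  have hAavg : δ - ε₁ ≤ avg fun z => dens {v | W z v ∈ A} := by
    have h1 : (avg fun z => dens {v | W z v ∈ A}) = avg fun w => avg fun v =>
        dens {y | join (fun q => (s.symm (v, w) q).or (g q.1)) y ∈ A} := by
      rw [avg_prod, avg_comm]
      refine congrArg avg (funext fun w => ?_)
      simp only [dens]
      rw [avg_comm]
      rfl
    rw [h1]
    have h2 : avg (fun _ : {q : Fin n × Fin M // ¬ g q.1 = none} → Option α =>
        avg fun _ : {q : Fin n × Fin M // g q.1 = none} → Option α => δ - ε₁) = δ - ε₁ := by
      simp only [avg_const]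
    rw [← h2]
    exact avg_mono fun w => avg_mono fun v => hslice _
  obtain ⟨z, hz⟩ := exists_avg_le fun z => dens {v | W z v ∈ A} - δ * (1 - dens (D z))
  rw [avg_sub, avg_const_mul, avg_sub, avg_const] at hz
  set B := {v | W z v ∈ A} with hB
  have hBline : ¬ HasLine B := fun hl => hA ((hW z).hasLine hl)
  have hcard : M ≤ Nat.card {q : Fin n × Fin M // g q.1 = none} := by
    have := Nat.card_le_card_of_injective
      (fun j : Fin M => (⟨(i₀, j), hi₀⟩ : {q : Fin n × Fin M // g q.1 = none}))
      fun i j hij => by simpa using hij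
    simpa using this
  have hcompl : avg ((D z)ᶜ.indicator
      fun v => B.indicator (fun _ => (1 : ℝ)) v - (δ + ε₀)) ≤ ε₀ := by
    refine hK _ ((le_max_left _ _).trans hcard) _ (C z) (fun v => ?_) (fun φ hφ => ?_) fun a v => ?_
    · linarith [indicator_one_le B v]
    · rw [avg_sub, avg_const, sub_nonpos]
      exact hm (Fin m) (by simp) {v | φ v ∈ B} fun hl => hBline (hφ.hasLine hl)
    · exact Iff.rfl
  have hsome := hK' {q : Fin n × Fin M // g q.1 = none} ((le_max_right _ _).trans hcard)
  have hpt : dens B ≤ avg fun v => {v | ∀ i, (v i).isSome}.indicator (fun _ => (1 : ℝ)) v +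
      ((D z)ᶜ.indicator (fun v => B.indicator (fun _ => (1 : ℝ)) v - (δ + ε₀)) v +
        (δ + ε₀) * (1 - (D z).indicator (fun _ => (1 : ℝ)) v)) := by
    refine avg_mono fun v => ?_
    by_cases hv : v ∈ D z
    · have hvB : v ∈ B → v ∈ {v : {q : Fin n × Fin M // g q.1 = none} → Option α |
          ∀ i, (v i).isSome} := by
        intro hvB
        by_contra hnone
        simp only [Set.mem_ofPred_eq, not_forall, Option.not_isSome_iff_eq_none] at hnone
        obtain ⟨i, hi⟩ := hnone
        refine hBline ⟨fun i => (v i).map some, ⟨i, by simp [hi]⟩, ?_⟩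
        rintro (_ | a)
        · have : fill (fun i => (v i).map some) none = v := by
            funext j
            rcases hj : v j with _ | c <;> simp [fill, hj]
          rwa [this]
        · have : fill (fun i => (v i).map some) (some a) = repl a v := by
            funext j
            rcases hj : v j with _ | c <;> simp [fill, repl, hj]
          rw [this]
          exact hv a (mem_univ a)
      by_cases hvB' : v ∈ B
      · rw [Set.indicator_of_mem hvB', Set.indicator_of_mem (hvB hvB')]
        simp [hv]
      · simpa [hv, hvB'] using indicator_one_nonneg _ v
    · simpa [hv] using indicator_one_nonneg _ v
  rw [avg_add, avg_add, avg_const_mul, avg_sub, avg_const] at hpt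
  simp only [dens] at hsome hDavg hz hpt hAavg
  have h1 : 0 ≤ dens (D z) := dens_nonneg _
  simp only [dens] at h1
  have h2 := mul_le_mul_of_nonneg_left hDavg hδ.le
  have h3 : ε₁ ≤ ε₀ := min_le_right _ _
  nlinarith

/-- The density Hales-Jewett property passes from an alphabet to the alphabet with one more
letter. -/
lemma HasDHJ.option (h : HasDHJ α) : HasDHJ (Option α) := by
  set S : Set ℝ := {δ | ∃ N : ℕ, ∀ (ι : Type) [Finite ι], N ≤ Nat.card ι →
      ∀ A : Set (ι → Option α), ¬ HasLine A → dens A ≤ δ} with hS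
  have hS1 : S.Nonempty := ⟨1, 0, fun ι _ _ A _ => dens_le_one A⟩
  have hS0 : BddBelow S := by
    refine ⟨0, ?_⟩
    rintro δ ⟨N, hN⟩
    refine (dens_nonneg (∅ : Set (Fin N → Option α))).trans (hN (Fin N) (by simp) ∅ ?_)
    rintro ⟨g, -, hg⟩
    exact hg none
  have hcrit : sInf S ≤ 0 := by
    by_contra! hpos
    obtain ⟨ε, hε, hdec⟩ := h.exists_dens_decrement hpos fun ε hε => by
      obtain ⟨s, ⟨N, hN⟩, hs⟩ := exists_lt_of_csInf_lt hS1 (lt_add_of_pos_right (sInf S) hε)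
      exact ⟨N, fun ι _ hι A hA => (hN ι hι A hA).trans hs.le⟩
    linarith [csInf_le hS0 (show sInf S - ε ∈ S from hdec)]
  intro δ hδ
  obtain ⟨s, ⟨N, hN⟩, hs⟩ := exists_lt_of_csInf_lt hS1 (hcrit.trans_lt hδ)
  refine ⟨N, fun ι _ hι A hA => ?_⟩
  by_contra hl
  linarith [hN ι hι A hl]

end Increment

lemma hasDHJ_of_subsingleton (α : Type) [Finite α] [Subsingleton α] : HasDHJ α := by
  intro δ hδ
  refine ⟨1, fun ι _ hι A hA => ?_⟩
  obtain ⟨x, hx⟩ := nonempty_of_dens_pos (hδ.trans_le hA)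
  obtain ⟨i⟩ := (Nat.card_pos_iff.mp hι).1
  refine ⟨fun _ => none, ⟨i, rfl⟩, fun a => ?_⟩
  rwa [Subsingleton.elim (fill _ a) x]

lemma HasDHJ.of_equiv {α β : Type} [Finite α] [Finite β] (e : α ≃ β) (h : HasDHJ α) :
    HasDHJ β := by
  intro δ hδ
  obtain ⟨N, hN⟩ := h δ hδ
  refine ⟨N, fun ι _ hι A hA => ?_⟩
  obtain ⟨g, ⟨i, hi⟩, hg⟩ := hN ι hι {x | e ∘ x ∈ A}
    (by rwa [← dens_preimage_equiv (Equiv.arrowCongr (Equiv.refl ι) e) A] at hA)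
  refine ⟨fun i => (g i).map e, ⟨i, by simp [hi]⟩, fun a => ?_⟩
  have : fill (fun i => (g i).map e) a = e ∘ fill g (e.symm a) := by
    funext j
    rcases hj : g j with _ | c <;> simp [fill, hj]
  rw [this]
  exact hg (e.symm a)

/-- The density Hales-Jewett theorem. -/
theorem hasDHJ (α : Type) [Finite α] : HasDHJ α := by
  have key : ∀ [Finite α], HasDHJ α := by
    refine Finite.induction_empty_option (P := fun α => ∀ [Finite α], HasDHJ α) ?_ ?_ ?_ α
    · intro α β e h _
      have := Finite.of_equiv β e.symm
      exact HasDHJ.of_equiv e h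
    · intro _
      exact hasDHJ_of_subsingleton PEmpty
    · intro α _ h _
      rcases isEmpty_or_nonempty α with hα | hα
      · exact hasDHJ_of_subsingleton (Option α)
      · exact HasDHJ.option h
  exact key

end DensityHalesJewett

namespace MeasureTheory.MeasurePreserving

open DensityHalesJewett Finset

variable {X : Type*} [MeasurableSpace X] {μ : Measure X} [IsProbabilityMeasure μ] {V : X → X}

/-- Along any finite family of times, some orbit visits a set with frequency at least the measure
of the set. -/
lemma exists_measureReal_le_dens (hV : MeasurePreserving V μ μ) {B : Set X}
    (hB : MeasurableSet B) {Ω : Type*} [Finite Ω] [Nonempty Ω] (s : Ω → ℕ) :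
    ∃ x, μ.real B ≤ dens {t | V^[s t] x ∈ B} := by
  cases nonempty_fintype Ω
  have hint : ∀ t, Integrable ((V^[s t] ⁻¹' B).indicator fun _ => (1 : ℝ)) μ := fun t =>
    (integrable_const 1).indicator ((hV.iterate (s t)).measurable hB)
  have hdens : ∀ x, dens {t | V^[s t] x ∈ B} * Nat.card Ω =
      ∑ t, (V^[s t] ⁻¹' B).indicator (fun _ => (1 : ℝ)) x := fun x => by
    rw [DensityHalesJewett.dens, avg_mul_card]
    exact sum_congr rfl fun t _ => by simp only [Set.indicator]; rfl
  obtain ⟨x, hx⟩ := exists_integral_le (integrable_finsetSum univ fun t _ => hint t)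
  refine ⟨x, ?_⟩
  have hcard : (0 : ℝ) < Nat.card Ω := by exact_mod_cast Nat.card_pos
  have hmeas : ∀ t, ∫ x, (V^[s t] ⁻¹' B).indicator (fun _ => (1 : ℝ)) x ∂μ = μ.real B := by
    intro t
    rw [integral_indicator_const _ ((hV.iterate (s t)).measurable hB), measureReal_def,
      (hV.iterate (s t)).measure_preimage hB.nullMeasurableSet]
    simp [measureReal_def]
  rw [integral_finsetSum _ fun t _ => hint t, sum_congr rfl fun t _ => hmeas t, ← hdens] at hx
  simp only [sum_const, card_univ, nsmul_eq_mul, ← Nat.card_eq_fintype_card] at hx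
  nlinarith

/-- A set of positive measure contains an orbit segment along an arithmetic progression. -/
lemma exists_forall_iterate_mem (hV : MeasurePreserving V μ μ) {B : Set X}
    (hB : MeasurableSet B) (hpos : 0 < μ.real B) (k : ℕ) :
    ∃ y ∈ B, ∃ n, 1 ≤ n ∧ ∀ i ≤ k, V^[n * i] y ∈ B := by
  obtain ⟨N, hN⟩ := hasDHJ (Fin (k + 1)) _ hpos
  obtain ⟨x, hx⟩ := hV.exists_measureReal_le_dens hB
    fun t : Fin N → Fin (k + 1) => ∑ j, (t j : ℕ)
  obtain ⟨g, ⟨j₀, hj₀⟩, hg⟩ := hN (Fin N) (by simp) _ hx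
  set d := #{j | g j = none} with hd
  have hsum : ∀ a : Fin (k + 1), ∑ j, (fill g a j).val = d * a + ∑ j, (fill g 0 j).val := by
    intro a
    rw [hd, card_filter, sum_mul, ← sum_add_distrib]
    refine sum_congr rfl fun j _ => ?_
    rcases hj : g j with _ | c <;> simp [fill, hj]
  refine ⟨V^[∑ j, (fill g 0 j).val] x, hg 0, d,
    card_pos.mpr ⟨j₀, by simpa using hj₀⟩, fun i hi => ?_⟩
  have := hg ⟨i, by omega⟩
  rwa [Set.mem_ofPred_eq, hsum, Function.iterate_add_apply] at this

end MeasureTheory.MeasurePreserving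

/-- Multiple recurrence for the powers of a single measure-preserving map: if `V` is a
measurable measure-preserving map on a probability space and `A` is measurable with
`μ A > 0`, then for every `k ≥ 1`, almost every `x ∈ A` satisfies `x ∈ V^{-n·i} A`
for some `n ≥ 1` and all `1 ≤ i ≤ k`. -/
theorem multiple_recurrence_powers {X : Type*} [MeasurableSpace X] (μ : Measure X)
    [IsProbabilityMeasure μ] (V : X → X) (hVmeas : Measurable V)
    (hVpres : ∀ A : Set X, MeasurableSet A → μ (V ⁻¹' A) = μ A)
    (A : Set X) (hA : MeasurableSet A) (hApos : 0 < μ A) :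
    ∀ k : ℕ, 1 ≤ k →
      ∀ᵐ x ∂μ, x ∈ A → ∃ n : ℕ, 1 ≤ n ∧ ∀ i : ℕ, 1 ≤ i → i ≤ k → x ∈ V^[n * i] ⁻¹' A := by
  intro k _
  have hV : MeasurePreserving V μ μ :=
    ⟨hVmeas, Measure.ext fun s hs => by rw [Measure.map_apply hVmeas hs, hVpres s hs]⟩
  set R : Set X := ⋃ n ∈ {n : ℕ | 1 ≤ n}, ⋂ i ∈ Set.Icc 1 k, V^[n * i] ⁻¹' A with hR
  have hmem : ∀ x, x ∈ R ↔
      ∃ n : ℕ, 1 ≤ n ∧ ∀ i : ℕ, 1 ≤ i → i ≤ k → x ∈ V^[n * i] ⁻¹' A := by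
    intro x
    simp only [hR, Set.mem_iUnion, Set.mem_iInter, Set.mem_Icc, Set.mem_ofPred_eq, exists_prop,
      and_imp]
  have hRmeas : MeasurableSet R :=
    .biUnion (Set.to_countable _) fun n _ => .biInter (Set.to_countable _) fun i _ =>
      hVmeas.iterate (n * i) hA
  have hnull : μ (A \ R) = 0 := by
    by_contra hne
    obtain ⟨y, hy, n, hn, hyn⟩ := hV.exists_forall_iterate_mem (hA.diff hRmeas)
      (ENNReal.toReal_pos hne (measure_ne_top μ _)) k
    exact hy.2 ((hmem y).mpr ⟨n, hn, fun i _ hi => (hyn i hi).1⟩)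
  filter_upwards [measure_eq_zero_iff_ae_notMem.mp hnull] with x hx hxA
  exact (hmem x).mp (by_contra fun hxR => hx ⟨hxA, hxR⟩)
end

section
/- Let P ⊆ {0,1}^ℕ be a Π⁰₁ class such that p = λ(P) > 0 and p is a computable real. Then every Schnorr random sequence Z ∈ {0,1}^ℕ is multiply recurrent in P. -/
open MeasureTheory

/-- `σ` is a prefix of the infinite binary sequence `Z`. -/
def IsPrefixOf (σ : List Bool) (Z : ℕ → Bool) : Prop :=
  ∀ i : ℕ, i < σ.length → σ.getD i false = Z i

/-- The open subset `⟦S⟧` of Cantor space generated by a set of finite binary strings. -/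
def openCl (S : Set (List Bool)) : Set (ℕ → Bool) :=
  {Z | ∃ σ ∈ S, IsPrefixOf σ Z}

/-- A set of finite binary strings is computably enumerable. -/
def CEStrings (S : Set (List Bool)) : Prop :=
  ∃ f : ℕ → Option (List Bool), Computable f ∧ S = {σ | ∃ n, f n = some σ}

/-- `P` is a Π⁰₁ class: the complement of the open set generated by a c.e. set of strings. -/
def Pi01Class (P : Set (ℕ → Bool)) : Prop :=
  ∃ S : Set (List Bool), CEStrings S ∧ P = (openCl S)ᶜ

/-- The shift operator `T` on Cantor space: `T Z n = Z (n+1)`. -/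
def shift (Z : ℕ → Bool) : ℕ → Bool := fun n => Z (n + 1)

/-- `Z` is `k`-recurrent in `P`: for some `n ≥ 1`, `T^{n i} Z ∈ P` for all `1 ≤ i ≤ k`. -/
def KRecurrentIn (k : ℕ) (P : Set (ℕ → Bool)) (Z : ℕ → Bool) : Prop :=
  ∃ n : ℕ, 1 ≤ n ∧ ∀ i : ℕ, 1 ≤ i → i ≤ k → shift^[n * i] Z ∈ P

/-- `Z` is multiply recurrent in `P`: `k`-recurrent in `P` for every `k ≥ 1`. -/
def MultiplyRecurrentIn (P : Set (ℕ → Bool)) (Z : ℕ → Bool) : Prop :=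
  ∀ k : ℕ, 1 ≤ k → KRecurrentIn k P Z

/-- `μ` is the uniform (fair-coin) product measure on Cantor space:
each basic cylinder determined by a string `σ` has measure `2^{-|σ|}`. -/
def IsUniformMeasure (μ : Measure (ℕ → Bool)) : Prop :=
  ∀ σ : List Bool, μ {Z | IsPrefixOf σ Z} = 2⁻¹ ^ σ.length

/-- A uniformly computably enumerable sequence of sets of strings. -/
def UniformlyCE (S : ℕ → Set (List Bool)) : Prop :=
  ∃ f : ℕ → ℕ → Option (List Bool), Computable₂ f ∧
    ∀ m, S m = {σ | ∃ n, f m n = some σ}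

/-- A Martin-Löf test with respect to the measure `μ`. -/
def MLTest (μ : Measure (ℕ → Bool)) (S : ℕ → Set (List Bool)) : Prop :=
  UniformlyCE S ∧ ∀ m, μ (openCl (S m)) ≤ 2⁻¹ ^ m

/-- `Z` is Martin-Löf random w.r.t. `μ`. -/
def MLRandom (μ : Measure (ℕ → Bool)) (Z : ℕ → Bool) : Prop :=
  ∀ S : ℕ → Set (List Bool), MLTest μ S → ∃ m, Z ∉ openCl (S m)

/-- A real is computable if some computable sequence of rationals approximates it
within `2^{-j}`. -/
def ComputableReal (x : ℝ) : Prop :=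
  ∃ q : ℕ → ℚ, Computable q ∧ ∀ j : ℕ, |x - (q j : ℝ)| ≤ 2⁻¹ ^ j

/-- A Schnorr test w.r.t. `μ`: a Martin-Löf test whose levels have uniformly
computable measures. -/
def SchnorrTest (μ : Measure (ℕ → Bool)) (S : ℕ → Set (List Bool)) : Prop :=
  UniformlyCE S ∧ (∀ m, μ (openCl (S m)) ≤ 2⁻¹ ^ m) ∧
    ∃ q : ℕ → ℕ → ℚ, Computable₂ q ∧
      ∀ m j : ℕ, |(μ (openCl (S m))).toReal - (q m j : ℝ)| ≤ 2⁻¹ ^ j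

/-- `Z` is Schnorr random w.r.t. `μ`. -/
def SchnorrRandom (μ : Measure (ℕ → Bool)) (Z : ℕ → Bool) : Prop :=
  ∀ S : ℕ → Set (List Bool), SchnorrTest μ S → ∃ m, Z ∉ openCl (S m)

/-- `Z` is weakly (Kurtz) random w.r.t. `μ`: it belongs to no Π⁰₁ class of measure `0`. -/
def KurtzRandom (μ : Measure (ℕ → Bool)) (Z : ℕ → Bool) : Prop :=
  ∀ P : Set (ℕ → Bool), Pi01Class P → μ P = 0 → Z ∉ P

open Encodable

/-! ### Computability of bounded quantifiers, bounded counting and unbounded search -/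

section Computability

variable {α : Type*} [Primcodable α]

theorem computable_count_lt {p : α → ℕ → Bool} (hp : Computable₂ p) {b : α → ℕ}
    (hb : Computable b) : Computable fun a => Nat.count (fun i => p a i = true) (b a) := by
  have h : Computable fun a => Nat.rec (motive := fun _ => ℕ) 0
      (fun y IH => bif p a y then IH + 1 else IH) (b a) := by
    refine Computable.nat_rec (h := fun a q => bif p a q.1 then q.2 + 1 else q.2) hb
      (Computable.const 0) ?_
    refine Computable.cond ?_ ?_ ?_
    · exact hp.comp Computable.fst (Computable.fst.comp Computable.snd)
    · exact Computable.succ.comp (Computable.snd.comp Computable.snd)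
    · exact Computable.snd.comp Computable.snd
  refine h.of_eq fun a => ?_
  induction b a with
  | zero => simp
  | succ n ih =>
    rw [Nat.count_succ, ← ih]
    cases h : p a n <;> simp only [h] <;> simp

theorem computable_exists_lt {p : α → ℕ → Bool} (hp : Computable₂ p) {b : α → ℕ}
    (hb : Computable b) : Computable fun a => decide (∃ i < b a, p a i = true) := by
  have h : Computable fun a => decide (0 < Nat.count (fun i => p a i = true) (b a)) :=
    (Primrec.nat_lt.decide.to_comp).comp (Computable.const 0) (computable_count_lt hp hb)
  refine h.of_eq fun a => ?_
  rw [decide_eq_decide, Nat.count_eq_card_filter_range, Finset.card_pos]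
  simp [Finset.Nonempty]

theorem computable_forall_lt {p : α → ℕ → Bool} (hp : Computable₂ p) {b : α → ℕ}
    (hb : Computable b) : Computable fun a => decide (∀ i < b a, p a i = true) := by
  have hp' : Computable₂ fun a i => !p a i := (Primrec.not.to_comp).comp hp
  refine ((Primrec.not.to_comp).comp (computable_exists_lt hp' hb)).of_eq fun a => ?_
  rw [← decide_not, decide_eq_decide]
  simp

theorem exists_computable_search {p : α → ℕ → Bool} (hp : Computable₂ p)
    (h : ∀ a, ∃ n, p a n = true) : ∃ f : α → ℕ, Computable f ∧ ∀ a, p a (f a) = true := by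
  have hr : Partrec fun a => Nat.rfind fun n => (p a n : Part Bool) := Partrec.rfind hp.partrec₂
  have hd : ∀ a, (Nat.rfind fun n => (p a n : Part Bool)).Dom := fun a => by
    obtain ⟨n, hn⟩ := h a
    exact Nat.rfind_dom.2 ⟨n, by simp [hn], fun _ => trivial⟩
  refine ⟨fun a => (Nat.rfind fun n => (p a n : Part Bool)).get (hd a), ?_, fun a => ?_⟩
  · exact hr.of_eq fun a => by simp
  · have := Nat.rfind_spec (Part.get_mem (hd a))
    simpa using this.2.symm

theorem Primrec.nat_pow' : Primrec₂ ((· ^ ·) : ℕ → ℕ → ℕ) := by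
  refine ((Primrec.nat_rec' (f := fun q : ℕ × ℕ => q.2) (g := fun _ => 1)
    (h := fun q r => r.2 * q.1) Primrec.snd (Primrec.const 1) ?_)).of_eq fun q => ?_
  · exact Primrec.nat_mul.comp (Primrec.snd.comp Primrec.snd) (Primrec.fst.comp Primrec.fst)
  · induction q.2 with
    | zero => simp
    | succ n ih => simp [pow_succ, ih]

end Computability

/-! ### Computable access to the encoding of rational numbers -/

/-- The code of the numerator and denominator of a rational number. -/
def ratCode (q : ℚ) : ℕ := Nat.pair (encode q.num) q.den

/-- Decides whether a number is the code of a reduced fraction. -/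
def isRatCode (y : ℕ) : Bool :=
  decide (∀ d < y.unpair.2 + 1, (decide ((y.unpair.1 + 1) / 2 % d = 0) &&
    decide (y.unpair.2 % d = 0) && !decide (d = 1)) = false) && decide (0 < y.unpair.2)

theorem encode_int_div_two (n : ℤ) : (encode n + 1) / 2 = n.natAbs := by
  change (Equiv.intEquivNat n + 1) / 2 = _
  cases n with
  | ofNat n => change (2 * n + 1) / 2 = n; omega
  | negSucc n => change (2 * n + 1 + 1) / 2 = n + 1; omega

theorem encode_int_mod_two (n : ℤ) : encode n % 2 = 0 ↔ 0 ≤ n := by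
  change Equiv.intEquivNat n % 2 = 0 ↔ _
  cases n with
  | ofNat n => change (2 * n) % 2 = 0 ↔ _; simp
  | negSucc n => change (2 * n + 1) % 2 = 0 ↔ _; simp

theorem isRatCode_iff (y : ℕ) : isRatCode y = true ↔ ∃ q, ratCode q = y := by
  have key : isRatCode y = true ↔
      0 < y.unpair.2 ∧ ((y.unpair.1 + 1) / 2).Coprime y.unpair.2 := by
    simp only [isRatCode, Bool.and_eq_true, decide_eq_true_eq, and_comm (b := 0 < _)]
    refine and_congr_right fun h => ⟨fun H => ?_, fun H d _ => ?_⟩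
    · have hg := H (((y.unpair.1 + 1) / 2).gcd y.unpair.2)
        (Nat.lt_succ_of_le (Nat.gcd_le_right _ h))
      simpa [Nat.mod_eq_zero_of_dvd (Nat.gcd_dvd_left _ _),
        Nat.mod_eq_zero_of_dvd (Nat.gcd_dvd_right _ _)] using hg
    · by_contra hc
      simp only [Bool.not_eq_false, Bool.and_eq_true, decide_eq_true_eq, Bool.not_eq_true',
        decide_eq_false_iff_not] at hc
      exact hc.2 (Nat.eq_one_of_dvd_coprimes H (Nat.dvd_of_mod_eq_zero hc.1.1)
        (Nat.dvd_of_mod_eq_zero hc.1.2))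
  rw [key]
  constructor
  · rintro ⟨h0, hc⟩
    refine ⟨⟨Denumerable.ofNat ℤ y.unpair.1, y.unpair.2, h0.ne', ?_⟩, ?_⟩
    · rw [← encode_int_div_two, Denumerable.encode_ofNat]
      exact hc
    · change Nat.pair (encode (Denumerable.ofNat ℤ y.unpair.1)) y.unpair.2 = y
      rw [Denumerable.encode_ofNat, Nat.pair_unpair]
  · rintro ⟨q, rfl⟩
    simp only [ratCode, Nat.unpair_pair, encode_int_div_two]
    exact ⟨q.pos, q.reduced⟩

/-- The code of a rational number used by the computability library. -/
def ratIndex (q : ℚ) : ℕ := @encode ℚ Primcodable.toEncodable q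

theorem ratIndex_eq (q : ℚ) :
    ratIndex q = Nat.count (fun y => isRatCode y = true) (ratCode q) := by
  have h : ratIndex q = (List.range (ratCode q)).countP
      (fun y => @decide (y ∈ Set.range (@encode ℚ Rat.instEncodable))
        (decidableRangeEncode ℚ y)) := rfl
  rw [h, Nat.count]
  refine List.countP_congr fun y _ => ?_
  simp only [decide_eq_true_eq, isRatCode_iff]
  rfl

theorem computable_isRatCode : Computable isRatCode := by
  have h1 : Computable fun y : ℕ => y.unpair.1 := Computable.fst.comp Computable.unpair
  have h2 : Computable fun y : ℕ => y.unpair.2 := Computable.snd.comp Computable.unpair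
  have hz : Computable₂ fun a b : ℕ => decide (a = b) := Primrec.eq.decide.to_comp
  have hmod : Computable₂ fun a b : ℕ => a % b := Primrec.nat_mod.to_comp
  have hdiv : Computable₂ fun a b : ℕ => a / b := Primrec.nat_div.to_comp
  have hin : Computable₂ fun (y d : ℕ) => !(decide ((y.unpair.1 + 1) / 2 % d = 0) &&
      decide (y.unpair.2 % d = 0) && !decide (d = 1)) := by
    refine Primrec.not.to_comp.comp (Primrec.and.to_comp.comp (Primrec.and.to_comp.comp
      (hz.comp (hmod.comp (hdiv.comp (Computable.succ.comp (h1.comp Computable.fst))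
        (Computable.const 2)) Computable.snd) (Computable.const 0))
      (hz.comp (hmod.comp (h2.comp Computable.fst) Computable.snd) (Computable.const 0)))
      (Primrec.not.to_comp.comp (hz.comp Computable.snd (Computable.const 1))))
  refine (Primrec.and.to_comp.comp (computable_forall_lt hin (Computable.succ.comp h2))
    (Primrec.nat_lt.decide.to_comp.comp (Computable.const 0) h2)).of_eq fun y => ?_
  simp only [isRatCode, Bool.not_eq_true']

theorem computable_ratCode : Computable ratCode := by
  have hp : Computable₂ fun (q : ℚ) (y : ℕ) => isRatCode y &&
      decide (Nat.count (fun i => isRatCode i = true) y = ratIndex q) := by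
    refine Primrec.and.to_comp.comp (computable_isRatCode.comp Computable.snd)
      (Primrec.eq.decide.to_comp.comp ?_ (Computable.encode.comp Computable.fst))
    exact computable_count_lt (α := ℚ × ℕ) (p := fun _ i => isRatCode i)
      (computable_isRatCode.comp Computable.snd) Computable.snd
  obtain ⟨f, hf, hfp⟩ := exists_computable_search hp fun q =>
    ⟨ratCode q, by simp [isRatCode_iff, ratIndex_eq]⟩
  refine hf.of_eq fun q => ?_
  have h := hfp q
  simp only [Bool.and_eq_true, decide_eq_true_eq, isRatCode_iff] at h
  obtain ⟨⟨q', hq'⟩, h⟩ := h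
  rw [← hq', ← ratIndex_eq] at h
  rw [← hq', @encode_injective ℚ Primcodable.toEncodable _ _ h]

theorem computable_dyadic : Computable₂ fun (x N : ℕ) => (x / 2 ^ N : ℚ) := by
  have hcode : Computable fun c : ℕ => ratCode (Denumerable.ofNat ℚ c) :=
    computable_ratCode.comp (Computable.ofNat ℚ)
  have hn : Computable fun c : ℕ => (ratCode (Denumerable.ofNat ℚ c)).unpair.1 :=
    Computable.fst.comp (Computable.unpair.comp hcode)
  have hd : Computable fun c : ℕ => (ratCode (Denumerable.ofNat ℚ c)).unpair.2 :=
    Computable.snd.comp (Computable.unpair.comp hcode)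
  have hz : Computable₂ fun a b : ℕ => decide (a = b) := Primrec.eq.decide.to_comp
  have hmul : Computable₂ fun a b : ℕ => a * b := Primrec.nat_mul.to_comp
  have hmod : Computable₂ fun a b : ℕ => a % b := Primrec.nat_mod.to_comp
  have hdiv : Computable₂ fun a b : ℕ => a / b := Primrec.nat_div.to_comp
  have hpow : Computable₂ fun a b : ℕ => a ^ b := Primrec.nat_pow'.to_comp
  have hp : Computable₂ fun (a : ℕ × ℕ) (c : ℕ) =>
      decide ((ratCode (Denumerable.ofNat ℚ c)).unpair.1 % 2 = 0) &&
      decide (((ratCode (Denumerable.ofNat ℚ c)).unpair.1 + 1) / 2 * 2 ^ a.2 =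
        a.1 * (ratCode (Denumerable.ofNat ℚ c)).unpair.2) := by
    refine Primrec.and.to_comp.comp
      (hz.comp (hmod.comp (hn.comp Computable.snd) (Computable.const 2)) (Computable.const 0))
      (hz.comp (hmul.comp (hdiv.comp (Computable.succ.comp (hn.comp Computable.snd))
        (Computable.const 2)) (hpow.comp (Computable.const 2)
          (Computable.snd.comp Computable.fst)))
        (hmul.comp (Computable.fst.comp Computable.fst) (hd.comp Computable.snd)))
  have hspec : ∀ (a : ℕ × ℕ) (q : ℚ), (encode q.num % 2 = 0 ∧
      (encode q.num + 1) / 2 * 2 ^ a.2 = a.1 * q.den) ↔ q = a.1 / 2 ^ a.2 := fun a q => by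
    rw [encode_int_div_two, encode_int_mod_two]
    constructor
    · rintro ⟨h0, h⟩
      have h' : ((q.num.natAbs : ℤ) : ℚ) * 2 ^ a.2 = a.1 * q.den := by exact_mod_cast h
      rw [Int.natAbs_of_nonneg h0] at h'
      rw [eq_div_iff (by positivity)]
      nth_rewrite 1 [← Rat.num_div_den q]
      rw [div_mul_eq_mul_div, h', mul_div_assoc, div_self (by exact_mod_cast q.den_nz), mul_one]
    · intro h
      have h0 : 0 ≤ q.num := by
        rw [Rat.num_nonneg, h]
        positivity
      refine ⟨h0, ?_⟩
      have h' : ((q.num.natAbs : ℤ) : ℚ) * 2 ^ a.2 = a.1 * q.den := by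
        rw [Int.natAbs_of_nonneg h0]
        rw [eq_div_iff (by positivity)] at h
        rw [← h]
        nth_rewrite 2 [← Rat.num_div_den q]
        have : (q.den : ℚ) ≠ 0 := by exact_mod_cast q.den_nz
        field_simp
      exact_mod_cast h'
  obtain ⟨f, hf, hfp⟩ := exists_computable_search hp fun a =>
    ⟨ratIndex (a.1 / 2 ^ a.2 : ℚ), by
      have hi : Denumerable.ofNat ℚ (ratIndex (a.1 / 2 ^ a.2 : ℚ)) = a.1 / 2 ^ a.2 :=
        Denumerable.ofNat_encode _
      rw [hi, Bool.and_eq_true, decide_eq_true_eq, decide_eq_true_eq, ratCode, Nat.unpair_pair]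
      exact (hspec a _).2 rfl⟩
  refine ((Computable.ofNat ℚ).comp hf).of_eq fun a => ?_
  rw [← hspec]
  simpa [ratCode] using hfp a

/-- The nonnegative part of the numerator of a rational number. -/
theorem computable_num_toNat : Computable fun q : ℚ => q.num.toNat := by
  have hn : Computable fun q : ℚ => (ratCode q).unpair.1 :=
    Computable.fst.comp (Computable.unpair.comp computable_ratCode)
  refine (Computable.cond (Primrec.eq.decide.to_comp.comp
    (Primrec.nat_mod.to_comp.comp hn (Computable.const 2)) (Computable.const 0))
    (Primrec.nat_div.to_comp.comp (Computable.succ.comp hn) (Computable.const 2))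
    (Computable.const 0)).of_eq fun q => ?_
  have h1 := encode_int_div_two q.num
  have h2 := encode_int_mod_two q.num
  simp only [ratCode, Nat.unpair_pair, Nat.succ_eq_add_one, h1]
  by_cases h : 0 ≤ q.num
  · simp only [h2.2 h, decide_true, cond_true]
    omega
  · simp only [mt h2.1 h, decide_false, cond_false]
    omega

theorem computable_den : Computable fun q : ℚ => q.den :=
  (Computable.snd.comp (Computable.unpair.comp computable_ratCode)).of_eq fun q => by
    simp [ratCode]

/-! ### Binary strings and initial segments -/

/-- The binary string of length `N` with the binary digits of `x`, least significant first. -/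
def bitString (N x : ℕ) : List Bool := (List.range N).map fun i => x.testBit i

/-- The initial segment of length `N` of a sequence. -/
def initSeg (Z : ℕ → Bool) (N : ℕ) : List Bool := (List.range N).map Z

@[simp] theorem length_bitString (N x : ℕ) : (bitString N x).length = N := by simp [bitString]

@[simp] theorem length_initSeg (Z : ℕ → Bool) (N : ℕ) : (initSeg Z N).length = N := by
  simp [initSeg]

theorem computable_bitString : Computable₂ bitString := by
  have htb : Primrec₂ fun x i : ℕ => x.testBit i := by
    refine (Primrec.eq.decide.comp (Primrec.nat_mod.comp (Primrec.nat_div.comp Primrec.fst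
      (Primrec.nat_pow'.comp (Primrec.const 2) Primrec.snd)) (Primrec.const 2))
      (Primrec.const 1)).of_eq fun q => ?_
    exact Nat.testBit_eq_decide_div_mod_eq.symm
  refine Primrec₂.to_comp (Primrec.list_map (f := fun q : ℕ × ℕ => List.range q.1)
    (g := fun q i => q.2.testBit i) (Primrec.list_range.comp Primrec.fst) ?_)
  exact htb.comp (Primrec.snd.comp Primrec.fst) Primrec.snd

theorem isPrefixOf_iff_initSeg {σ : List Bool} {Z : ℕ → Bool} :
    IsPrefixOf σ Z ↔ initSeg Z σ.length = σ := by
  constructor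
  · intro h
    refine List.ext_getElem (by simp) fun i h1 h2 => ?_
    have := h i h2
    rw [List.getD_eq_getElem _ _ h2] at this
    simp [initSeg, this]
  · intro h i hi
    rw [← h, List.getD_eq_getElem _ _ (by simpa using hi)]
    simp [initSeg]

theorem bitString_injOn {N x y : ℕ} (hx : x < 2 ^ N) (hy : y < 2 ^ N)
    (h : bitString N x = bitString N y) : x = y := by
  refine Nat.eq_of_testBit_eq fun i => ?_
  rcases lt_or_ge i N with hi | hi
  · have := congrArg (fun l => l[i]?) h
    simpa [bitString, hi] using this
  · have h2 : 2 ^ N ≤ 2 ^ i := Nat.pow_le_pow_right two_pos hi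
    rw [Nat.testBit_lt_two_pow (hx.trans_le h2), Nat.testBit_lt_two_pow (hy.trans_le h2)]

theorem exists_bitString_eq_initSeg (Z : ℕ → Bool) (N : ℕ) :
    ∃ x < 2 ^ N, bitString N x = initSeg Z N := by
  refine ⟨Nat.ofBits fun i : Fin N => Z i, Nat.ofBits_lt_two_pow _, ?_⟩
  refine List.map_congr_left fun i hi => ?_
  rw [Nat.testBit_ofBits_lt _ _ (List.mem_range.1 hi)]

/-! ### Decidable approximations to the complement of a `Π⁰₁` class -/

/-- Whether `σ` occurs in `τ` at position `o`. -/
def occursAt (q : ℕ × List Bool) (σ : List Bool) : Bool :=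
  decide (∀ i < σ.length, decide (σ[i]? = q.2[q.1 + i]?) = true)

/-- Whether `τ`, with its first `o` entries removed, extends one of the strings enumerated by `f`
in at most `|τ| - o` steps. -/
def enumMeets (f : ℕ → Option (List Bool)) (o : ℕ) (τ : List Bool) : Bool :=
  decide (∃ t < τ.length - o, (f t).elim false (occursAt (o, τ)) = true)

/-- Whether for each `j < J` there is `i` with `1 ≤ i ≤ k` such that `τ` shifted by
`L * (k + 1) ^ j * i` extends one of the strings enumerated by `f`. -/
def blocksMeet (f : ℕ → Option (List Bool)) (k J L : ℕ) (τ : List Bool) : Bool :=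
  decide (∀ j < J, decide (∃ i < k, enumMeets f (L * (k + 1) ^ j * (i + 1)) τ = true) = true)

theorem computable_occursAt : Computable₂ occursAt := by
  have hin : Computable₂ fun (q : (ℕ × List Bool) × List Bool) (i : ℕ) =>
      decide (q.2[i]? = q.1.2[q.1.1 + i]?) := by
    have h1 : Computable fun r : ((ℕ × List Bool) × List Bool) × ℕ => r.1.2 :=
      Computable.snd.comp Computable.fst
    have h2 : Computable fun r : ((ℕ × List Bool) × List Bool) × ℕ => r.1.1.1 :=
      Computable.fst.comp (Computable.fst.comp Computable.fst)
    have h3 : Computable fun r : ((ℕ × List Bool) × List Bool) × ℕ => r.1.1.2 :=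
      Computable.snd.comp (Computable.fst.comp Computable.fst)
    exact Primrec.eq.decide.to_comp.comp (Primrec.list_getElem?.to_comp.comp h1 Computable.snd)
      (Primrec.list_getElem?.to_comp.comp h3 (Primrec.nat_add.to_comp.comp h2 Computable.snd))
  exact computable_forall_lt hin (Primrec.list_length.to_comp.comp Computable.snd)

theorem computable_enumMeets {f : ℕ → Option (List Bool)} (hf : Computable f) :
    Computable₂ (enumMeets f) := by
  have hfn : Computable fun r : (ℕ × List Bool) × ℕ => f r.2 := hf.comp Computable.snd
  have hocc : Computable₂ fun (r : (ℕ × List Bool) × ℕ) (σ : List Bool) => occursAt r.1 σ :=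
    computable_occursAt.comp (Computable.fst.comp Computable.fst) Computable.snd
  have hel : Computable₂ fun (q : ℕ × List Bool) (t : ℕ) => (f t).elim false (occursAt q) := by
    refine (Computable.option_casesOn hfn (Computable.const false) hocc).of_eq fun r => ?_
    cases h : f r.2 <;> simp only [h] <;> rfl
  have hb : Computable fun q : ℕ × List Bool => q.2.length - q.1 :=
    Primrec.nat_sub.to_comp.comp (Primrec.list_length.to_comp.comp Computable.snd) Computable.fst
  exact (computable_exists_lt hel hb).of_eq fun q => rfl

theorem computable_blocksMeet {f : ℕ → Option (List Bool)} (hf : Computable f) (k : ℕ) :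
    Computable fun q : (ℕ × ℕ) × List Bool => blocksMeet f k q.1.1 q.1.2 q.2 := by
  have hmul : Computable₂ fun a b : ℕ => a * b := Primrec.nat_mul.to_comp
  have hpow : Computable₂ fun a b : ℕ => a ^ b := Primrec.nat_pow'.to_comp
  have hin : Computable₂ fun (q : ((ℕ × ℕ) × List Bool) × ℕ) (i : ℕ) =>
      enumMeets f (q.1.1.2 * (k + 1) ^ q.2 * (i + 1)) q.1.2 := by
    have h1 : Computable fun r : (((ℕ × ℕ) × List Bool) × ℕ) × ℕ => r.1.1.1.2 :=
      Computable.snd.comp (Computable.fst.comp (Computable.fst.comp Computable.fst))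
    have h2 : Computable fun r : (((ℕ × ℕ) × List Bool) × ℕ) × ℕ => r.1.1.2 :=
      Computable.snd.comp (Computable.fst.comp Computable.fst)
    have h3 : Computable fun r : (((ℕ × ℕ) × List Bool) × ℕ) × ℕ => r.1.2 :=
      Computable.snd.comp Computable.fst
    exact (computable_enumMeets hf).comp (hmul.comp (hmul.comp h1
      (hpow.comp (Computable.const (k + 1)) h3)) (Computable.succ.comp Computable.snd)) h2
  exact computable_forall_lt (computable_exists_lt hin (Computable.const k)).to₂
    (Computable.fst.comp Computable.fst)

/-- The stage `L` approximation to the open set enumerated by `f`. -/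
def stageOpen (f : ℕ → Option (List Bool)) (L : ℕ) : Set (ℕ → Bool) :=
  {Z | ∃ t < L, ∃ σ, f t = some σ ∧ σ.length ≤ L ∧ IsPrefixOf σ Z}

theorem shift_iterate (Z : ℕ → Bool) (o : ℕ) : shift^[o] Z = fun n => Z (o + n) := by
  induction o generalizing Z with
  | zero => simp
  | succ o ih =>
    rw [Function.iterate_succ_apply, ih]
    funext n
    exact congrArg Z (by omega)

theorem enumMeets_initSeg (f : ℕ → Option (List Bool)) (o N : ℕ) (Z : ℕ → Bool) :
    enumMeets f o (initSeg Z N) = true ↔ shift^[o] Z ∈ stageOpen f (N - o) := by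
  simp only [enumMeets, decide_eq_true_eq, length_initSeg, stageOpen, Set.mem_ofPred_eq]
  refine exists_congr fun t => and_congr_right fun ht => ?_
  rcases f t with _ | σ
  · simp
  simp only [Option.elim_some, occursAt, decide_eq_true_eq, Option.some.injEq, exists_eq_left',
    shift_iterate, IsPrefixOf]
  constructor
  · intro h
    have hlt : ∀ i < σ.length, o + i < N := fun i hi => by
      have := h i hi
      rw [List.getElem?_eq_getElem hi, eq_comm, List.getElem?_eq_some_iff] at this
      simpa using this.1
    refine ⟨?_, fun i hi => ?_⟩
    · rcases Nat.eq_zero_or_pos σ.length with h0 | h0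
      · omega
      · have := hlt (σ.length - 1) (by omega)
        omega
    · have := h i hi
      rw [List.getElem?_eq_getElem hi] at this
      rw [List.getD_eq_getElem _ _ hi]
      simpa [initSeg, hlt i hi] using this
  · rintro ⟨hl, h⟩ i hi
    have := h i hi
    rw [List.getD_eq_getElem _ _ hi] at this
    rw [List.getElem?_eq_getElem hi, this]
    simp [initSeg, show o + i < N by omega]

theorem blocksMeet_initSeg (f : ℕ → Option (List Bool)) (k J L N : ℕ) (Z : ℕ → Bool) :
    blocksMeet f k J L (initSeg Z N) = true ↔ ∀ j < J, ∃ i < k,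
      shift^[L * (k + 1) ^ j * (i + 1)] Z ∈ stageOpen f (N - L * (k + 1) ^ j * (i + 1)) := by
  simp only [blocksMeet, decide_eq_true_eq, enumMeets_initSeg]

theorem stageOpen_mono (f : ℕ → Option (List Bool)) : Monotone (stageOpen f) :=
  fun _ _ h _ ⟨t, ht, σ, hσ, hl, hp⟩ => ⟨t, ht.trans_le h, σ, hσ, hl.trans h, hp⟩

theorem iUnion_stageOpen (f : ℕ → Option (List Bool)) :
    ⋃ L, stageOpen f L = openCl {σ | ∃ n, f n = some σ} := by
  ext Z
  simp only [Set.mem_iUnion, stageOpen, openCl, Set.mem_ofPred_eq]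
  constructor
  · rintro ⟨L, t, _, σ, hσ, _, hp⟩
    exact ⟨σ, ⟨t, hσ⟩, hp⟩
  · rintro ⟨σ, ⟨t, hσ⟩, hp⟩
    exact ⟨t + σ.length + 1, t, by omega, σ, hσ, by omega, hp⟩

/-! ### The uniform measure -/

section Measure

variable {μ : Measure (ℕ → Bool)}

theorem measurableSet_isPrefixOf (σ : List Bool) : MeasurableSet {Z | IsPrefixOf σ Z} := by
  have : {Z : ℕ → Bool | IsPrefixOf σ Z} =
      ⋂ i ∈ Finset.range σ.length, (fun Z : ℕ → Bool => Z i) ⁻¹' {σ.getD i false} := by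
    ext Z
    simp [IsPrefixOf, eq_comm]
  rw [this]
  exact Finset.measurableSet_biInter _ fun i _ =>
    measurable_pi_apply i (measurableSet_singleton _)

theorem IsUniformMeasure.isProbabilityMeasure (hμ : IsUniformMeasure μ) :
    IsProbabilityMeasure μ := by
  refine ⟨?_⟩
  have := hμ []
  simpa [IsPrefixOf] using this

theorem isPrefixOf_append {σ τ : List Bool} {Z : ℕ → Bool} :
    IsPrefixOf (σ ++ τ) Z ↔ IsPrefixOf σ Z ∧ IsPrefixOf τ (shift^[σ.length] Z) := by
  simp only [IsPrefixOf, shift_iterate, List.length_append]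
  constructor
  · intro h
    refine ⟨fun i hi => ?_, fun i hi => ?_⟩
    · rw [← h i (by omega), List.getD_append _ _ _ _ hi]
    · rw [← h (σ.length + i) (by omega), List.getD_append_right _ _ _ _ (by omega)]
      simp
  · rintro ⟨h1, h2⟩ i hi
    rcases lt_or_ge i σ.length with h | h
    · rw [List.getD_append _ _ _ _ h, h1 i h]
    · rw [List.getD_append_right _ _ _ _ h, h2 _ (by omega), Nat.add_sub_cancel' h]

theorem generateFrom_cylinders :
    (MeasurableSpace.pi : MeasurableSpace (ℕ → Bool)) =
      MeasurableSpace.generateFrom (Set.range fun σ : List Bool => {Z | IsPrefixOf σ Z}) := by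
  refine le_antisymm ?_ (MeasurableSpace.generateFrom_le ?_)
  · refine iSup_le fun i => ?_
    rw [← measurable_iff_comap_le]
    refine @measurable_to_bool _ (_) _ ?_
    have : (fun Z : ℕ → Bool => Z i) ⁻¹' {true} =
        ⋃ σ ∈ {σ : List Bool | i < σ.length ∧ σ.getD i false = true}, {Z | IsPrefixOf σ Z} := by
      ext Z
      simp only [Set.mem_preimage, Set.mem_singleton_iff, Set.mem_iUnion, Set.mem_ofPred_eq,
        exists_prop]
      constructor
      · intro h
        refine ⟨initSeg Z (i + 1), ⟨by simp, ?_⟩, ?_⟩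
        · simp [initSeg, h]
        · rw [isPrefixOf_iff_initSeg, length_initSeg]
      · rintro ⟨σ, ⟨h1, h2⟩, h3⟩
        rw [← h3 i h1, h2]
    rw [this]
    refine MeasurableSet.biUnion (Set.to_countable _) fun σ _ => ?_
    exact MeasurableSpace.measurableSet_generateFrom ⟨σ, rfl⟩
  · rintro _ ⟨σ, rfl⟩
    exact measurableSet_isPrefixOf σ

theorem isPiSystem_cylinders :
    IsPiSystem (Set.range fun σ : List Bool => {Z : ℕ → Bool | IsPrefixOf σ Z}) := by
  have key : ∀ (σ τ : List Bool) (Z : ℕ → Bool), IsPrefixOf σ Z → IsPrefixOf τ Z →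
      σ.length ≤ τ.length → {Z | IsPrefixOf τ Z} ⊆ {Z | IsPrefixOf σ Z} := by
    intro σ τ Z h1 h2 hl Z' h i hi
    rw [h1 i hi, ← h2 i (by omega), h i (by omega)]
  rintro _ ⟨σ, rfl⟩ _ ⟨τ, rfl⟩ ⟨Z, h1, h2⟩
  rcases le_total σ.length τ.length with hl | hl
  · exact ⟨τ, (Set.inter_eq_right.2 (key σ τ Z h1 h2 hl)).symm⟩
  · exact ⟨σ, (Set.inter_eq_left.2 (key τ σ Z h2 h1 hl)).symm⟩

theorem measurable_shift_iterate (o : ℕ) : Measurable (shift^[o]) := by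
  refine Measurable.iterate ?_ o
  exact measurable_pi_lambda _ fun n => measurable_pi_apply (n + 1)

theorem IsUniformMeasure.cylinder_inter (hμ : IsUniformMeasure μ) (σ : List Bool)
    {B : Set (ℕ → Bool)} (hB : MeasurableSet B) :
    μ ({Z | IsPrefixOf σ Z} ∩ shift^[σ.length] ⁻¹' B) = 2⁻¹ ^ σ.length * μ B := by
  have := hμ.isProbabilityMeasure
  have hfin : (2⁻¹ : ENNReal) ^ σ.length ≠ ⊤ := by simp
  have h : (μ.restrict {Z | IsPrefixOf σ Z}).map (shift^[σ.length]) =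
      ((2⁻¹ : ENNReal) ^ σ.length) • μ := by
    refine ext_of_generate_finite _ generateFrom_cylinders isPiSystem_cylinders ?_ ?_
    · rintro _ ⟨τ, rfl⟩
      rw [Measure.map_apply (measurable_shift_iterate _) (measurableSet_isPrefixOf τ),
        Measure.restrict_apply (measurable_shift_iterate _ (measurableSet_isPrefixOf τ)),
        Set.inter_comm]
      have : {Z | IsPrefixOf σ Z} ∩ shift^[σ.length] ⁻¹' {Z | IsPrefixOf τ Z} =
          {Z | IsPrefixOf (σ ++ τ) Z} := by
        ext Z
        simp [isPrefixOf_append]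
      rw [this, hμ, Measure.smul_apply, hμ, List.length_append, pow_add, smul_eq_mul]
    · rw [Measure.map_apply (measurable_shift_iterate _) MeasurableSet.univ]
      simp [hμ σ]
  have h' := congrArg (fun ν => ν B) h
  simp only [Measure.smul_apply, smul_eq_mul] at h'
  rw [← h', Measure.map_apply (measurable_shift_iterate _) hB,
    Measure.restrict_apply (measurable_shift_iterate _ hB), Set.inter_comm]

theorem setOf_initSeg_eq_biUnion (D : List Bool → Prop) [DecidablePred D] (N : ℕ) :
    {Z | D (initSeg Z N)} = ⋃ x ∈ (Finset.range (2 ^ N)).filter fun x => D (bitString N x),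
      {Z | IsPrefixOf (bitString N x) Z} := by
  ext Z
  simp only [Set.mem_iUnion, Set.mem_ofPred_eq, Finset.mem_filter, Finset.mem_range, exists_prop,
    isPrefixOf_iff_initSeg, length_bitString]
  constructor
  · intro h
    obtain ⟨x, hx, hxe⟩ := exists_bitString_eq_initSeg Z N
    exact ⟨x, ⟨hx, hxe ▸ h⟩, hxe.symm⟩
  · rintro ⟨x, ⟨_, h⟩, hxe⟩
    exact hxe ▸ h

theorem measure_setOf_initSeg (ν : Measure (ℕ → Bool)) (D : List Bool → Prop) [DecidablePred D]
    (N : ℕ) : ν {Z | D (initSeg Z N)} =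
      ∑ x ∈ (Finset.range (2 ^ N)).filter fun x => D (bitString N x),
        ν {Z | IsPrefixOf (bitString N x) Z} := by
  rw [setOf_initSeg_eq_biUnion, measure_biUnion_finset]
  · intro x hx y hy hne
    simp only [Finset.coe_filter, Finset.mem_range, Set.mem_ofPred_eq] at hx hy
    refine Set.disjoint_left.2 fun Z h1 h2 => hne ?_
    simp only [Set.mem_ofPred_eq, isPrefixOf_iff_initSeg, length_bitString] at h1 h2
    exact bitString_injOn hx.1 hy.1 (h1.symm.trans h2)
  · exact fun x _ => measurableSet_isPrefixOf _

theorem measurableSet_setOf_initSeg (D : List Bool → Prop) (N : ℕ) :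
    MeasurableSet {Z | D (initSeg Z N)} := by
  classical
  rw [setOf_initSeg_eq_biUnion]
  exact Finset.measurableSet_biUnion _ fun x _ => measurableSet_isPrefixOf _

theorem IsUniformMeasure.setOf_initSeg (hμ : IsUniformMeasure μ) (D : List Bool → Bool) (N : ℕ) :
    μ {Z | D (initSeg Z N) = true} =
      Nat.count (fun x => D (bitString N x) = true) (2 ^ N) * 2⁻¹ ^ N := by
  rw [measure_setOf_initSeg μ (fun τ => D τ = true), Nat.count_eq_card_filter_range,
    Finset.sum_congr rfl fun x _ => hμ (bitString N x)]
  simp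

theorem IsUniformMeasure.setOf_initSeg_inter (hμ : IsUniformMeasure μ) (D : List Bool → Prop)
    (N : ℕ) {B : Set (ℕ → Bool)} (hB : MeasurableSet B) :
    μ ({Z | D (initSeg Z N)} ∩ shift^[N] ⁻¹' B) = μ {Z | D (initSeg Z N)} * μ B := by
  classical
  have hm := measurable_shift_iterate N hB
  rw [← Measure.restrict_apply' hm, measure_setOf_initSeg, measure_setOf_initSeg, Finset.sum_mul]
  refine Finset.sum_congr rfl fun x _ => ?_
  rw [Measure.restrict_apply' hm, hμ]
  simpa using hμ.cylinder_inter (bitString N x) hB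

/-- A set is determined by the first `N` coordinates. -/
def DeterminedBy (N : ℕ) (A : Set (ℕ → Bool)) : Prop :=
  ∀ Z Z' : ℕ → Bool, (∀ i < N, Z i = Z' i) → Z ∈ A → Z' ∈ A

theorem DeterminedBy.eq_setOf {N : ℕ} {A : Set (ℕ → Bool)} (h : DeterminedBy N A) :
    A = {Z | (fun i => (initSeg Z N).getD i false) ∈ A} := by
  have hi : ∀ (Z : ℕ → Bool), ∀ i < N, Z i = (initSeg Z N).getD i false := fun Z i hi => by
    simp [initSeg, hi]
  ext Z
  exact ⟨h _ _ (hi Z), h _ _ fun i hin => (hi Z i hin).symm⟩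

theorem DeterminedBy.measurableSet {N : ℕ} {A : Set (ℕ → Bool)} (h : DeterminedBy N A) :
    MeasurableSet A := by
  rw [h.eq_setOf]
  exact measurableSet_setOf_initSeg (fun τ => (fun i => τ.getD i false) ∈ A) N

theorem IsUniformMeasure.inter_preimage_shift (hμ : IsUniformMeasure μ) {N : ℕ}
    {A B : Set (ℕ → Bool)} (hA : DeterminedBy N A) (hB : MeasurableSet B) :
    μ (A ∩ shift^[N] ⁻¹' B) = μ A * μ B := by
  rw [hA.eq_setOf]
  exact hμ.setOf_initSeg_inter (fun τ => (fun i => τ.getD i false) ∈ A) N hB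

theorem IsUniformMeasure.preimage_shift (hμ : IsUniformMeasure μ) (N : ℕ)
    {B : Set (ℕ → Bool)} (hB : MeasurableSet B) : μ (shift^[N] ⁻¹' B) = μ B := by
  have := hμ.isProbabilityMeasure
  have h := hμ.inter_preimage_shift (N := N) (A := Set.univ) (fun _ _ _ h => h) hB
  simpa using h


theorem IsUniformMeasure.real_inter_preimage_shift (hμ : IsUniformMeasure μ) {N : ℕ}
    {A B : Set (ℕ → Bool)} (hA : DeterminedBy N A) (hB : MeasurableSet B) :
    μ.real (A ∩ shift^[N] ⁻¹' B) = μ.real A * μ.real B := by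
  simp only [Measure.real, hμ.inter_preimage_shift hA hB, ENNReal.toReal_mul]

theorem IsUniformMeasure.real_preimage_shift (hμ : IsUniformMeasure μ) (N : ℕ)
    {B : Set (ℕ → Bool)} (hB : MeasurableSet B) : μ.real (shift^[N] ⁻¹' B) = μ.real B := by
  simp only [Measure.real, hμ.preimage_shift N hB]

theorem DeterminedBy.mono {N M : ℕ} {A : Set (ℕ → Bool)} (h : DeterminedBy N A) (hNM : N ≤ M) :
    DeterminedBy M A :=
  fun Z Z' hZ => h Z Z' fun i hi => hZ i (hi.trans_le hNM)

theorem DeterminedBy.compl {N : ℕ} {A : Set (ℕ → Bool)} (h : DeterminedBy N A) :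
    DeterminedBy N Aᶜ :=
  fun Z Z' hZ hA hA' => hA (h Z' Z (fun i hi => (hZ i hi).symm) hA')

theorem DeterminedBy.preimage_shift {N : ℕ} {A : Set (ℕ → Bool)} (h : DeterminedBy N A) (o : ℕ) :
    DeterminedBy (o + N) (shift^[o] ⁻¹' A) := by
  intro Z Z' hZ hA
  refine h _ _ (fun i hi => ?_) hA
  rw [shift_iterate, shift_iterate]
  exact hZ _ (by omega)

/-- Multiples of `M ≥ L` give independent shifts of sets determined by `L` coordinates. -/
theorem IsUniformMeasure.real_forall_shift (hμ : IsUniformMeasure μ) {L M : ℕ} (hLM : L ≤ M)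
    {D : Set (ℕ → Bool)} (hD : DeterminedBy L D) (k : ℕ) :
    MeasurableSet {Z | ∀ i < k, shift^[M * i] Z ∈ D} ∧
      μ.real {Z | ∀ i < k, shift^[M * i] Z ∈ D} = μ.real D ^ k := by
  have := hμ.isProbabilityMeasure
  induction k with
  | zero => simp
  | succ k ih =>
    have h : {Z | ∀ i < k + 1, shift^[M * i] Z ∈ D} =
        D ∩ shift^[M] ⁻¹' {Z | ∀ i < k, shift^[M * i] Z ∈ D} := by
      ext Z
      simp only [Set.mem_inter_iff, Set.mem_preimage, Set.mem_ofPred_eq,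
        ← Function.iterate_add_apply]
      constructor
      · intro h
        exact ⟨by simpa using h 0 (by omega), fun i hi => h (i + 1) (by omega)⟩
      · rintro ⟨h0, h⟩ i hi
        rcases i with _ | i
        · simpa using h0
        · exact h i (by omega)
    rw [h]
    refine ⟨hD.measurableSet.inter (measurable_shift_iterate M ih.1), ?_⟩
    rw [hμ.real_inter_preimage_shift (hD.mono hLM) ih.1, ih.2, pow_succ, mul_comm]

/-- The sequences some shift of which by `L * (k + 1) ^ j * i` with `1 ≤ i ≤ k` lies in `C`, for
each `j < J`. -/
def blockHits (k J L : ℕ) (C : Set (ℕ → Bool)) : Set (ℕ → Bool) :=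
  {Z | ∀ j < J, ∃ i < k, shift^[L * (k + 1) ^ j * (i + 1)] Z ∈ C}

theorem blockHits_succ (k J L : ℕ) (C : Set (ℕ → Bool)) :
    blockHits k (J + 1) L C = blockHits k J L C ∩ shift^[L * (k + 1) ^ J] ⁻¹'
      {Z | ∀ i < k, shift^[L * (k + 1) ^ J * i] Z ∈ Cᶜ}ᶜ := by
  ext Z
  simp only [blockHits, Set.mem_inter_iff, Set.mem_preimage, Set.mem_ofPred_eq, Set.mem_compl_iff,
    ← Function.iterate_add_apply, Nat.forall_lt_succ_right, not_forall, not_not, exists_prop,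
    mul_add_one]

theorem DeterminedBy.blockHits {L : ℕ} {C : Set (ℕ → Bool)} (hC : DeterminedBy L C) (k J : ℕ) :
    DeterminedBy (L * (k + 1) ^ J) (blockHits k J L C) := by
  intro Z Z' hZ h j hj
  obtain ⟨i, hi, hZi⟩ := h j hj
  refine ⟨i, hi, (hC.preimage_shift _).mono ?_ Z Z' hZ hZi⟩
  calc L * (k + 1) ^ j * (i + 1) + L
      ≤ L * (k + 1) ^ j * k + L * (k + 1) ^ j := by
        gcongr
        · exact hi
        · exact Nat.le_mul_of_pos_right _ (by positivity)
    _ = L * (k + 1) ^ (j + 1) := by ring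
    _ ≤ L * (k + 1) ^ J := by
        gcongr
        · omega
        · exact hj

theorem IsUniformMeasure.real_blockHits (hμ : IsUniformMeasure μ) {L : ℕ} {C : Set (ℕ → Bool)}
    (hC : DeterminedBy L C) (k J : ℕ) :
    μ.real (blockHits k J L C) = (1 - μ.real Cᶜ ^ k) ^ J := by
  have := hμ.isProbabilityMeasure
  induction J with
  | zero => simp [_root_.blockHits]
  | succ J ih =>
    obtain ⟨hm, he⟩ := hμ.real_forall_shift (M := L * (k + 1) ^ J)
      (Nat.le_mul_of_pos_right _ (by positivity)) hC.compl k
    rw [blockHits_succ, hμ.real_inter_preimage_shift (hC.blockHits k J) hm.compl, ih,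
      measureReal_compl hm, he, pow_succ]
    simp

theorem IsUniformMeasure.real_shift_union_bound (hμ : IsUniformMeasure μ) (k J : ℕ)
    (a : ℕ → ℕ → ℕ) {U : Set (ℕ → Bool)} (hU : MeasurableSet U) {V : ℕ → ℕ → Set (ℕ → Bool)}
    (hV : ∀ j i, MeasurableSet (V j i)) {ε : ℝ}
    (hε : ∀ j < J, ∀ i < k, μ.real (U \ V j i) ≤ ε) :
    μ.real {Z | ∀ j < J, ∃ i < k, shift^[a j i] Z ∈ U} ≤
      μ.real {Z | ∀ j < J, ∃ i < k, shift^[a j i] Z ∈ V j i} + (J * k : ℕ) * ε := by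
  have := hμ.isProbabilityMeasure
  have hsub : {Z | ∀ j < J, ∃ i < k, shift^[a j i] Z ∈ U} ⊆
      {Z | ∀ j < J, ∃ i < k, shift^[a j i] Z ∈ V j i} ∪
        ⋃ q ∈ Finset.range J ×ˢ Finset.range k, shift^[a q.1 q.2] ⁻¹' (U \ V q.1 q.2) := by
    intro Z hZ
    by_contra hc
    rw [Set.mem_union, not_or] at hc
    refine hc.1 fun j hj => ?_
    obtain ⟨i, hi, hZi⟩ := hZ j hj
    refine ⟨i, hi, ?_⟩
    by_contra hn
    refine hc.2 (Set.mem_biUnion (x := (j, i)) ?_ ⟨hZi, hn⟩)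
    simp [hj, hi]
  refine (measureReal_mono hsub).trans ((measureReal_union_le _ _).trans ?_)
  gcongr
  refine (measureReal_biUnion_finset_le _ _).trans ?_
  calc ∑ q ∈ Finset.range J ×ˢ Finset.range k, μ.real (shift^[a q.1 q.2] ⁻¹' (U \ V q.1 q.2))
      ≤ ∑ _q ∈ Finset.range J ×ˢ Finset.range k, ε := by
        refine Finset.sum_le_sum fun q hq => ?_
        rw [hμ.real_preimage_shift _ (hU.diff (hV _ _))]
        simp only [Finset.mem_product, Finset.mem_range] at hq
        exact hε _ hq.1 _ hq.2
    _ = (J * k : ℕ) * ε := by simp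

theorem determinedBy_stageOpen (f : ℕ → Option (List Bool)) (L : ℕ) :
    DeterminedBy L (stageOpen f L) := by
  rintro Z Z' hZ ⟨t, ht, σ, hσ, hl, hp⟩
  exact ⟨t, ht, σ, hσ, hl, fun i hi => (hp i hi).trans (hZ i (by omega))⟩

theorem IsUniformMeasure.real_setOf_initSeg (hμ : IsUniformMeasure μ) (D : List Bool → Bool)
    (N : ℕ) : μ.real {Z | D (initSeg Z N) = true} =
      (Nat.count (fun x => D (bitString N x) = true) (2 ^ N) / 2 ^ N : ℝ) := by
  rw [Measure.real, hμ.setOf_initSeg D N]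
  simp [div_eq_mul_inv]

theorem openCl_blocksMeet (f : ℕ → Option (List Bool)) (k J L : ℕ) :
    openCl {τ | blocksMeet f k J L τ = true} =
      blockHits k J L (openCl {σ | ∃ n, f n = some σ}) := by
  rw [← iUnion_stageOpen]
  ext Z
  constructor
  · rintro ⟨τ, hτ, hp⟩ j hj
    rw [isPrefixOf_iff_initSeg] at hp
    rw [Set.mem_ofPred_eq, ← hp, blocksMeet_initSeg] at hτ
    obtain ⟨i, hi, h⟩ := hτ j hj
    exact ⟨i, hi, Set.mem_iUnion_of_mem _ h⟩
  · intro h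
    have hev : ∀ j ∈ {j | j < J}, ∀ᶠ N in Filter.atTop, ∃ i < k,
        shift^[L * (k + 1) ^ j * (i + 1)] Z ∈
          stageOpen f (N - L * (k + 1) ^ j * (i + 1)) := fun j hj => by
      obtain ⟨i, hi, hZ⟩ := h j hj
      obtain ⟨M, hM⟩ := Set.mem_iUnion.1 hZ
      filter_upwards [Filter.eventually_ge_atTop (M + L * (k + 1) ^ j * (i + 1))] with N hN
      exact ⟨i, hi, stageOpen_mono f (by omega) hM⟩
    obtain ⟨N, hN⟩ := ((Filter.eventually_all_finite (Set.finite_lt_nat J)).2 hev).exists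
    refine ⟨initSeg Z N, ?_, ?_⟩
    · exact (blocksMeet_initSeg f k J L N Z).2 hN
    · rw [isPrefixOf_iff_initSeg, length_initSeg]

end Measure

theorem exists_computable_modulus {p : ℝ} (hp0 : 0 ≤ p) (hp : ComputableReal p) {c : ℕ → ℕ}
    (hc : Computable c)
    (hlim : Filter.Tendsto (fun L => (c L / 2 ^ L : ℝ)) Filter.atTop (nhds (1 - p))) :
    ∃ e : ℕ → ℕ, Computable e ∧ ∀ j, 1 - p - c (e j) / 2 ^ e j ≤ (2⁻¹ : ℝ) ^ j := by
  obtain ⟨q, hq, hqp⟩ := hp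
  have hmul : Computable₂ fun a b : ℕ => a * b := Primrec.nat_mul.to_comp
  have hadd : Computable₂ fun a b : ℕ => a + b := Primrec.nat_add.to_comp
  have hpow : Computable fun b : ℕ => 2 ^ b :=
    Primrec.nat_pow'.to_comp.comp (Computable.const 2) Computable.id
  have hn : Computable fun j => (q (j + 2)).num.toNat :=
    computable_num_toNat.comp (hq.comp (Computable.succ.comp Computable.succ))
  have hd : Computable fun j => (q (j + 2)).den :=
    computable_den.comp (hq.comp (Computable.succ.comp Computable.succ))
  have hs : Computable₂ fun j L : ℕ => decide (2 ^ L * ((q (j + 2)).den * 2 ^ (j + 1)) <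
      c L * ((q (j + 2)).den * 2 ^ (j + 1)) + (q (j + 2)).num.toNat * (2 ^ L * 2 ^ (j + 1)) +
        (q (j + 2)).den * 2 ^ L) := by
    have h1 : Computable fun r : ℕ × ℕ => 2 ^ r.2 := hpow.comp Computable.snd
    have h2 : Computable fun r : ℕ × ℕ => (q (r.1 + 2)).den := hd.comp Computable.fst
    have h3 : Computable fun r : ℕ × ℕ => 2 ^ (r.1 + 1) :=
      hpow.comp (Computable.succ.comp Computable.fst)
    have h4 : Computable fun r : ℕ × ℕ => (q (r.1 + 2)).num.toNat := hn.comp Computable.fst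
    have h5 : Computable fun r : ℕ × ℕ => c r.2 := hc.comp Computable.snd
    have h6 := hmul.comp h2 h3
    exact Primrec.nat_lt.decide.to_comp.comp (hmul.comp h1 h6)
      (hadd.comp (hadd.comp (hmul.comp h5 h6) (hmul.comp h4 (hmul.comp h1 h3)))
        (hmul.comp h2 h1))
  have hspec : ∀ j L : ℕ, (2 ^ L * ((q (j + 2)).den * 2 ^ (j + 1)) <
      c L * ((q (j + 2)).den * 2 ^ (j + 1)) + (q (j + 2)).num.toNat * (2 ^ L * 2 ^ (j + 1)) +
        (q (j + 2)).den * 2 ^ L) ↔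
      1 < (c L / 2 ^ L : ℝ) + max (q (j + 2) : ℝ) 0 + 2⁻¹ ^ (j + 1) := fun j L => by
    have hd0 : (0 : ℝ) < (q (j + 2)).den := by exact_mod_cast (q (j + 2)).pos
    have hmax : max (q (j + 2) : ℝ) 0 = (q (j + 2)).num.toNat / (q (j + 2)).den := by
      have hnum : (((q (j + 2)).num.toNat : ℕ) : ℝ) = max ((q (j + 2)).num : ℝ) 0 := by
        have : (((q (j + 2)).num.toNat : ℕ) : ℤ) = max (q (j + 2)).num 0 := Int.toNat_eq_max _
        exact_mod_cast congrArg (Int.cast : ℤ → ℝ) this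
      rw [hnum, ← max_div_div_right hd0.le, zero_div]
      congr 1
      exact_mod_cast (Rat.num_div_den (q (j + 2))).symm
    rw [hmax, ← Nat.cast_lt (α := ℝ)]
    push_cast
    have : (c L / 2 ^ L : ℝ) + (q (j + 2)).num.toNat / (q (j + 2)).den + 2⁻¹ ^ (j + 1) =
        (c L * ((q (j + 2)).den * 2 ^ (j + 1)) + (q (j + 2)).num.toNat * (2 ^ L * 2 ^ (j + 1)) +
          (q (j + 2)).den * 2 ^ L) / (2 ^ L * ((q (j + 2)).den * 2 ^ (j + 1))) := by
      rw [inv_pow]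
      field_simp
    rw [this, one_lt_div (by positivity)]
  have happ : ∀ j, |p - max (q (j + 2) : ℝ) 0| ≤ 2⁻¹ ^ (j + 2) := fun j => by
    refine le_trans ?_ (hqp (j + 2))
    have := abs_max_sub_max_le_abs p (q (j + 2) : ℝ) 0
    rwa [max_eq_left hp0] at this
  have hhalf : ∀ j : ℕ, (2⁻¹ : ℝ) ^ (j + 1) = 2 * 2⁻¹ ^ (j + 2) ∧
      (2⁻¹ : ℝ) ^ j = 4 * 2⁻¹ ^ (j + 2) ∧ (0 : ℝ) < 2⁻¹ ^ (j + 2) := fun j =>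
    ⟨by ring, by ring, by positivity⟩
  obtain ⟨e, he, hes⟩ := exists_computable_search hs fun j => by
    simp only [decide_eq_true_eq, hspec]
    obtain ⟨h1, -, h3⟩ := hhalf j
    have := abs_le.1 (happ j)
    obtain ⟨L, hL⟩ := (hlim.eventually_const_lt
      (show 1 - max (q (j + 2) : ℝ) 0 - 2⁻¹ ^ (j + 1) < 1 - p by linarith)).exists
    exact ⟨L, by linarith⟩
  refine ⟨e, he, fun j => ?_⟩
  have h := hes j
  simp only [decide_eq_true_eq, hspec] at h
  obtain ⟨h1, h2, h3⟩ := hhalf j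
  have := abs_le.1 (happ j)
  linarith

theorem exists_enumeration_of_computable {α : Type*} [Primcodable α] {D : ℕ → α → Bool}
    (hD : Computable₂ D) : ∃ g : ℕ → ℕ → Option α, Computable₂ g ∧
      ∀ m, {τ | D m τ = true} = {τ | ∃ n, g m n = some τ} := by
  refine ⟨fun m n => (decode (α := α) n).bind fun τ => bif D m τ then some τ else none, ?_,
    fun m => ?_⟩
  · refine Computable.option_bind (f := fun r : ℕ × ℕ => (decode r.2 : Option α))
      (g := fun r τ => bif D r.1 τ then some τ else none)
      (Computable.decode.comp Computable.snd) ?_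
    exact Computable.cond (hD.comp (Computable.fst.comp Computable.fst) Computable.snd)
      (Computable.option_some.comp Computable.snd) (Computable.const none)
  · ext τ
    constructor
    · intro h
      rw [Set.mem_ofPred_eq] at h
      exact ⟨encode τ, by simp [h]⟩
    · rintro ⟨n, hn⟩
      obtain ⟨τ', -, h⟩ := Option.bind_eq_some_iff.1 hn
      rw [Set.mem_ofPred_eq]
      cases hb : D m τ' <;> simp_all

theorem mul_inv_two_pow_le (a j : ℕ) : (a : ℝ) * 2⁻¹ ^ (j + a) ≤ 2⁻¹ ^ j := by
  have h : (a : ℝ) ≤ 2 ^ a := by exact_mod_cast (Nat.lt_two_pow_self).le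
  rw [pow_add, mul_left_comm, inv_pow 2 a, ← div_eq_mul_inv (a : ℝ)]
  exact mul_le_of_le_one_right (by positivity) ((div_le_one (by positivity)).2 h)

theorem computable_count_bitString {α : Type*} [Primcodable α] {D : α → List Bool → Bool}
    (hD : Computable₂ D) {N : α → ℕ} (hN : Computable N) :
    Computable fun a => Nat.count (fun x => D a (bitString (N a) x) = true) (2 ^ N a) := by
  have hbits : Computable₂ fun (a : α) (x : ℕ) => bitString (N a) x :=
    computable_bitString.comp (hN.comp Computable.fst) Computable.snd
  have hDbits : Computable₂ fun (a : α) (x : ℕ) => D a (bitString (N a) x) :=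
    hD.comp Computable.fst hbits
  have hpow : Computable fun a => 2 ^ N a :=
    Primrec.nat_pow'.to_comp.comp (Computable.const 2) hN
  exact computable_count_lt hDbits hpow

theorem computable_count_bitString_div {α : Type*} [Primcodable α] {D : α → List Bool → Bool}
    (hD : Computable₂ D) {N : α → ℕ} (hN : Computable N) :
    Computable fun a =>
      (Nat.count (fun x => D a (bitString (N a) x) = true) (2 ^ N a) / 2 ^ N a : ℚ) :=
  computable_dyadic.comp (computable_count_bitString hD hN) hN

/-- If the stages from `L` on approximate the open set `U` well enough, then the set of sequences
all of whose first `J` blocks hit `U` is small. -/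
theorem IsUniformMeasure.real_blockHits_le {μ : Measure (ℕ → Bool)} (hμ : IsUniformMeasure μ)
    {f : ℕ → Option (List Bool)} {U : Set (ℕ → Bool)} (hU : MeasurableSet U)
    {k J L m c : ℕ} (hVU : stageOpen f L ⊆ U)
    (hc : (1 - μ.real Uᶜ ^ k) ^ c < 2⁻¹) (hJ : J = c * (m + 1))
    (hdiff : μ.real (U \ stageOpen f L) ≤ 2⁻¹ ^ (m + 1 + J * k)) :
    μ.real (blockHits k J L U) ≤ 2⁻¹ ^ m := by
  have := hμ.isProbabilityMeasure
  have hp1 : μ.real Uᶜ ≤ 1 := measureReal_le_one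
  have h1 := hμ.real_shift_union_bound k J (fun j i => L * (k + 1) ^ j * (i + 1)) hU
    (V := fun _ _ => stageOpen f L) (fun _ _ => (determinedBy_stageOpen f L).measurableSet)
    (fun j _ i _ => hdiff)
  have h2 := hμ.real_blockHits (determinedBy_stageOpen f L) k J
  have h3 := mul_inv_two_pow_le (J * k) (m + 1)
  have h4 : μ.real Uᶜ ≤ μ.real (stageOpen f L)ᶜ :=
    measureReal_mono (Set.compl_subset_compl.2 hVU)
  have h5 : μ.real (stageOpen f L)ᶜ ≤ 1 := measureReal_le_one
  have h6 : (1 - μ.real (stageOpen f L)ᶜ ^ k) ^ J ≤ (2⁻¹ : ℝ) ^ (m + 1) :=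
    calc (1 - μ.real (stageOpen f L)ᶜ ^ k) ^ J ≤ (1 - μ.real Uᶜ ^ k) ^ J := by
          gcongr
          exact sub_nonneg.2 (pow_le_one₀ measureReal_nonneg h5)
      _ = ((1 - μ.real Uᶜ ^ k) ^ c) ^ (m + 1) := by rw [hJ, pow_mul]
      _ ≤ (2⁻¹ : ℝ) ^ (m + 1) := by
          gcongr
          exact pow_nonneg (sub_nonneg.2 (pow_le_one₀ measureReal_nonneg hp1)) c
  calc μ.real (blockHits k J L U)
      ≤ μ.real (blockHits k J L (stageOpen f L)) +
          (J * k : ℕ) * 2⁻¹ ^ (m + 1 + J * k) := h1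
    _ ≤ 2⁻¹ ^ (m + 1) + 2⁻¹ ^ (m + 1) := add_le_add (h2.trans_le h6) h3
    _ = 2⁻¹ ^ m := by ring

/-- The measure of the set of sequences all of whose first `J` blocks hit `U` is approximated
by looking at sufficiently long initial segments. -/
theorem IsUniformMeasure.abs_real_blockHits_sub_le {μ : Measure (ℕ → Bool)}
    (hμ : IsUniformMeasure μ) {f : ℕ → Option (List Bool)} {U : Set (ℕ → Bool)}
    (hU : MeasurableSet U) {k J L j M : ℕ} (hVU : ∀ L, stageOpen f L ⊆ U)
    (hdiff : ∀ L, M ≤ L → μ.real (U \ stageOpen f L) ≤ 2⁻¹ ^ (j + J * k)) :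
    |μ.real (blockHits k J L U) -
      μ.real {Z | blocksMeet f k J L (initSeg Z (L * (k + 1) ^ J + M)) = true}| ≤ 2⁻¹ ^ j := by
  have := hμ.isProbabilityMeasure
  have h1 := hμ.real_shift_union_bound k J (fun j i => L * (k + 1) ^ j * (i + 1)) hU
    (V := fun j' i => stageOpen f (L * (k + 1) ^ J + M - L * (k + 1) ^ j' * (i + 1)))
    (fun _ _ => (determinedBy_stageOpen f _).measurableSet)
    (ε := 2⁻¹ ^ (j + J * k)) (fun j' hj' i hi => hdiff _ (by
      have : L * (k + 1) ^ j' * (i + 1) ≤ L * (k + 1) ^ J :=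
        calc L * (k + 1) ^ j' * (i + 1) ≤ L * (k + 1) ^ j' * (k + 1) := by gcongr
          _ = L * (k + 1) ^ (j' + 1) := by ring
          _ ≤ L * (k + 1) ^ J := by
            gcongr
            · omega
            · exact hj'
      omega))
  simp only [← blocksMeet_initSeg] at h1
  have h2 : μ.real {Z | blocksMeet f k J L (initSeg Z (L * (k + 1) ^ J + M)) = true} ≤
      μ.real (blockHits k J L U) := by
    refine measureReal_mono fun Z hZ => ?_
    rw [Set.mem_ofPred_eq, blocksMeet_initSeg] at hZ
    exact fun j hj => (hZ j hj).imp fun i hi => ⟨hi.1, hVU _ hi.2⟩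
  have h3 := mul_inv_two_pow_le (J * k) j
  change μ.real (blockHits k J L U) ≤ _ at h1
  rw [abs_le]
  constructor <;> linarith [show (0 : ℝ) ≤ 2⁻¹ ^ j by positivity]

/-- Every Schnorr random sequence is multiply recurrent in every Π⁰₁ class of
positive computable measure. -/
theorem schnorrRandom_multiplyRecurrent_pi01 (μ : Measure (ℕ → Bool))
    (hμ : IsUniformMeasure μ) (P : Set (ℕ → Bool)) (hP : Pi01Class P)
    (hPpos : 0 < μ P) (hPcomp : ComputableReal (μ P).toReal)
    (Z : ℕ → Bool) (hZ : SchnorrRandom μ Z) :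
    MultiplyRecurrentIn P Z := by
  have := hμ.isProbabilityMeasure
  obtain ⟨S, ⟨f, hf, rfl⟩, rfl⟩ := hP
  set U := openCl {σ | ∃ n, f n = some σ} with hUdef
  have hVm : ∀ L, MeasurableSet (stageOpen f L) := fun L =>
    (determinedBy_stageOpen f L).measurableSet
  have hVU : ∀ L, stageOpen f L ⊆ U := fun L => by
    rw [hUdef, ← iUnion_stageOpen]
    exact Set.subset_iUnion _ L
  have hU : MeasurableSet U := by
    rw [hUdef, ← iUnion_stageOpen]
    exact MeasurableSet.iUnion hVm
  set p : ℝ := μ.real Uᶜ with hp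
  have hp0 : 0 < p := ENNReal.toReal_pos hPpos.ne' (measure_ne_top _ _)
  have hUp : μ.real U = 1 - p := by
    rw [hp, measureReal_compl hU]
    simp
  have hc : Computable fun L =>
      Nat.count (fun x => enumMeets f 0 (bitString L x) = true) (2 ^ L) :=
    computable_count_bitString (D := fun _ => enumMeets f 0)
      ((computable_enumMeets hf).comp (Computable.const 0) Computable.snd) Computable.id
  have hVc : ∀ L, μ.real (stageOpen f L) =
      (Nat.count (fun x => enumMeets f 0 (bitString L x) = true) (2 ^ L) / 2 ^ L : ℝ) := fun L => by
    rw [← hμ.real_setOf_initSeg]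
    congr 1
    ext Z
    rw [Set.mem_ofPred_eq, enumMeets_initSeg]
    simp
  obtain ⟨e, he, hes⟩ := exists_computable_modulus hp0.le hPcomp hc (by
    simp only [← hVc, ← hUp]
    have h := tendsto_measure_iUnion_atTop (μ := μ) (stageOpen_mono f)
    rw [iUnion_stageOpen] at h
    exact (ENNReal.tendsto_toReal (measure_ne_top μ _)).comp h)
  have hdiff : ∀ j L, e j ≤ L → μ.real (U \ stageOpen f L) ≤ 2⁻¹ ^ j := fun j L hL => by
    rw [measureReal_sdiff (hVU L) (hVm L)]
    have h1 := hes j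
    rw [← hVc, ← hUp] at h1
    have h2 : μ.real (stageOpen f (e j)) ≤ μ.real (stageOpen f L) :=
      measureReal_mono (stageOpen_mono f hL)
    linarith
  intro k hk
  by_contra hrec
  have hpk : 0 < p ^ k := pow_pos hp0 k
  obtain ⟨c, hc2⟩ := exists_pow_lt_of_lt_one (show (0 : ℝ) < 2⁻¹ by norm_num)
    (show 1 - p ^ k < 1 by linarith)
  set J : ℕ → ℕ := fun m => c * (m + 1) with hJ
  set L : ℕ → ℕ := fun m => e (m + 1 + J m * k) + 1 with hL
  have hmul : Computable₂ fun a b : ℕ => a * b := Primrec.nat_mul.to_comp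
  have hadd : Computable₂ fun a b : ℕ => a + b := Primrec.nat_add.to_comp
  have hJc : Computable J := hmul.comp (Computable.const c) Computable.succ
  have hJk : Computable fun m => J m * k := hmul.comp hJc (Computable.const k)
  have hLc : Computable L := Computable.succ.comp (he.comp (hadd.comp Computable.succ hJk))
  have hD : Computable₂ fun m τ => blocksMeet f k (J m) (L m) τ :=
    (computable_blocksMeet hf k).comp (Computable.pair (Computable.pair (hJc.comp Computable.fst)
      (hLc.comp Computable.fst)) Computable.snd)
  have hbound : ∀ m, μ.real (blockHits k (J m) (L m) U) ≤ 2⁻¹ ^ m := fun m =>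
    hμ.real_blockHits_le hU (hVU _) hc2 rfl (hdiff (m + 1 + J m * k) (L m) (Nat.le_succ _))
  set N : ℕ → ℕ → ℕ := fun m j => L m * (k + 1) ^ J m + e (j + J m * k) with hN
  have hNc : Computable₂ N := by
    have hpk : Computable fun m => (k + 1) ^ J m :=
      Primrec.nat_pow'.to_comp.comp (Computable.const (k + 1)) hJc
    exact hadd.comp ((hmul.comp hLc hpk).comp Computable.fst)
      (he.comp (hadd.comp Computable.snd (hJk.comp Computable.fst)))
  have happrox : ∀ m j, |μ.real (blockHits k (J m) (L m) U) -
      μ.real {Z | blocksMeet f k (J m) (L m) (initSeg Z (N m j)) = true}| ≤ 2⁻¹ ^ j := fun m j =>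
    hμ.abs_real_blockHits_sub_le hU hVU (hdiff (j + J m * k))
  obtain ⟨g, hg, hgS⟩ := exists_enumeration_of_computable hD
  obtain ⟨m, hm⟩ := hZ (fun m => {τ | blocksMeet f k (J m) (L m) τ = true}) <| by
    refine ⟨⟨g, hg, hgS⟩, fun m => ?_, fun m j => (Nat.count (fun x => blocksMeet f k (J m) (L m)
      (bitString (N m j) x) = true) (2 ^ N m j) / 2 ^ N m j : ℚ), ?_, fun m j => ?_⟩
    · rw [openCl_blocksMeet, ← ENNReal.ofReal_toReal (measure_ne_top μ _)]
      refine ENNReal.ofReal_le_of_le_toReal ((hbound m).trans_eq ?_)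
      simp
    · exact computable_count_bitString_div (α := ℕ × ℕ)
        (D := fun a τ => blocksMeet f k (J a.1) (L a.1) τ) (N := fun a => N a.1 a.2)
        (hD.comp (Computable.fst.comp Computable.fst) Computable.snd) hNc
    · have h := happrox m j
      rw [hμ.real_setOf_initSeg] at h
      rw [openCl_blocksMeet]
      push_cast
      exact h
  refine hm ?_
  rw [openCl_blocksMeet]
  intro j _
  by_contra hj
  refine hrec ⟨L m * (k + 1) ^ j, Nat.mul_pos (Nat.succ_pos _) (by positivity),
    fun i hi hik hZU => ?_⟩
  refine hj ⟨i - 1, by omega, ?_⟩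
  rwa [Nat.sub_add_cancel hi]
end
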